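/- arXiv:2605.00995 — 3 statements merged into one kernel-verified Lean document; each statement's English description precedes it below -/
import Mathlib

section
/- There exists a constant δ₃ > 0 such that for every m and every function Q : 𝔽₂^m → 𝔽₂ of degree at most 3, |Pr_{X ~ Unif(𝔽₂^m)}[Q(X) = 1] − 1/3| ≥ δ₃. -/
open Finset

/-- Distribution of `f(X)` on `β` for `X` uniform on the finite type `α`. -/
noncomputable def distOf {α β : Type*} [Fintype α] [DecidableEq β] (f : α → β) (y : β) : ℝ :=
  ((Finset.univ.filter fun x => f x = y).card : ℝ) / (Fintype.card α : ℝ)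

/-- Output distribution on `𝔽₂ⁿ` of the tuple `(P₁(X),…,Pₙ(X))` for uniform `X ∈ 𝔽₂^m`. -/
noncomputable def outDist {m n : ℕ} (P : Fin n → (Fin m → ZMod 2) → ZMod 2) :
    (Fin n → ZMod 2) → ℝ :=
  distOf (fun x i => P i x)

/-- Total variation distance between two distributions on a finite type. -/
noncomputable def tvDist {β : Type*} [Fintype β] (μ ν : β → ℝ) : ℝ :=
  (1 / 2) * ∑ y, |μ y - ν y|

/-- The distribution `Ber(1/3)^{⊗n}` on `𝔽₂ⁿ`. -/
noncomputable def ber13 {n : ℕ} (y : Fin n → ZMod 2) : ℝ :=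
  (1 / 3 : ℝ) ^ (Finset.univ.filter fun i => y i = 1).card *
    (2 / 3 : ℝ) ^ (n - (Finset.univ.filter fun i => y i = 1).card)

/-- `P : 𝔽₂^m → 𝔽₂` has degree at most `d`. -/
def DegLE {m : ℕ} (d : ℕ) (P : (Fin m → ZMod 2) → ZMod 2) : Prop :=
  ∃ p : MvPolynomial (Fin m) (ZMod 2), p.totalDegree ≤ d ∧ ∀ x, MvPolynomial.eval x p = P x

/-- `rank_{d'}(P) ≤ k`. -/
def RankLE {m : ℕ} (d' k : ℕ) (P : (Fin m → ZMod 2) → ZMod 2) : Prop :=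
  ∃ (Q : Fin k → (Fin m → ZMod 2) → ZMod 2) (Γ : (Fin k → ZMod 2) → ZMod 2),
    (∀ j, DegLE d' (Q j)) ∧ ∀ x, P x = Γ (fun j => Q j x)

/-- `Pr_{X uniform}[P(X) = 1]`. -/
noncomputable def prOne {m : ℕ} (P : (Fin m → ZMod 2) → ZMod 2) : ℝ :=
  distOf P 1


/-! ### Signs -/

def chi (a : ZMod 2) : ℤ := if a = 0 then 1 else -1

lemma chi_add (a b : ZMod 2) : chi (a + b) = chi a * chi b := by
  revert a b; decide

lemma chi_sum_hom {A : Type*} [AddCommGroup A] [Fintype A] (φ : A → ZMod 2)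
    (hφ : ∀ x y, φ (x + y) = φ x + φ y) :
    ((∀ x, φ x = 0) ∧ ∑ x, chi (φ x) = Fintype.card A) ∨
      ((¬ ∀ x, φ x = 0) ∧ ∑ x, chi (φ x) = 0) := by
  by_cases h : ∀ x, φ x = 0
  · left
    refine ⟨h, ?_⟩
    simp [h, chi]
  · right
    refine ⟨h, ?_⟩
    push Not at h
    obtain ⟨a, ha⟩ := h
    have h1 : chi (φ a) = -1 := by simp [chi, ha]
    have h2 : ∑ x, chi (φ x) = ∑ x, chi (φ (x + a)) :=
      (Equiv.sum_comp (Equiv.addRight a) (fun x => chi (φ x))).symm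
    have h3 : ∑ x, chi (φ (x + a)) = - ∑ x, chi (φ x) := by
      rw [← Finset.sum_neg_distrib]
      refine Finset.sum_congr rfl fun x _ => ?_
      rw [hφ, chi_add, h1]; ring
    linarith

lemma z2_self (a : ZMod 2) : a + a = 0 := by revert a; decide

lemma quad_sq {W : Type*} [AddCommGroup W] [Fintype W] (g : W → ZMod 2)
    (B : W →+ W →+ ZMod 2) (hB : ∀ x y, g (x + y) = g x + g y + g 0 + B x y) :
    (∑ x, chi (g x)) ^ 2 = 0 ∨
      (∑ x, chi (g x)) ^ 2 = (Nat.card W : ℤ) * (Nat.card B.ker : ℤ) := by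
  classical
  have e1 : (∑ x, chi (g x)) ^ 2 = ∑ h, chi (g h + g 0) * ∑ x, chi (B h x) := by
    rw [sq, Finset.sum_mul_sum]
    have : ∀ x, ∑ y, chi (g x) * chi (g y) = ∑ h, chi (g h + g 0) * chi (B h x) := by
      intro x
      rw [← Equiv.sum_comp (Equiv.addRight x) (fun y => chi (g x) * chi (g y))]
      refine Finset.sum_congr rfl fun h _ => ?_
      rw [← chi_add, ← chi_add]
      congr 1
      simp only [Equiv.coe_addRight]
      rw [hB]
      have := z2_self (g x)
      linear_combination this
    simp_rw [this]
    rw [Finset.sum_comm]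
    simp_rw [Finset.mul_sum]
  have e2 : ∀ h, ∑ x, chi (B h x) = if h ∈ B.ker then (Nat.card W : ℤ) else 0 := by
    intro h
    rcases chi_sum_hom (fun x => B h x) (fun x y => map_add (B h) x y) with ⟨h1, h2⟩ | ⟨h1, h2⟩
    · rw [h2, if_pos, Nat.card_eq_fintype_card]
      rw [AddMonoidHom.mem_ker]; ext x; exact h1 x
    · rw [h2, if_neg]
      intro hh
      rw [AddMonoidHom.mem_ker] at hh
      exact h1 fun x => by simp [hh]
  have e3 : (∑ x, chi (g x)) ^ 2 = (Nat.card W : ℤ) * ∑ h : B.ker, chi (g h + g 0) := by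
    rw [e1, Finset.mul_sum]
    simp_rw [e2]
    rw [← Finset.sum_subtype (Finset.univ.filter (· ∈ B.ker)) (by simp)
      (fun h => (Nat.card W : ℤ) * chi (g h + g 0)), Finset.sum_filter]
    refine Finset.sum_congr rfl fun h _ => ?_
    split_ifs <;> ring
  rcases chi_sum_hom (fun h : B.ker => g h + g 0) (by
    rintro ⟨x, hx⟩ ⟨y, hy⟩
    have : B x = 0 := hx
    simp only [AddSubgroup.coe_add]
    rw [hB, this]
    simp only [AddMonoidHom.zero_apply]
    ring) with ⟨h1, h2⟩ | ⟨h1, h2⟩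
  · right; rw [e3, h2, Nat.card_eq_fintype_card (α := B.ker)]
  · left; rw [e3, h2]; simp

lemma quad_val {W : Type*} [AddCommGroup W] [Fintype W] (g : W → ZMod 2)
    (B : W →+ W →+ ZMod 2) (hB : ∀ x y, g (x + y) = g x + g y + g 0 + B x y)
    {m : ℕ} (hm : Nat.card W ∣ 2 ^ m) :
    ∑ x, chi (g x) = 0 ∨ ∃ k ≤ m, ∑ x, chi (g x) = 2 ^ k ∨ ∑ x, chi (g x) = - 2 ^ k := by
  obtain ⟨w, hwm, hw⟩ := (Nat.dvd_prime_pow Nat.prime_two).1 hm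
  have hK : Nat.card B.ker ∣ 2 ^ w := hw ▸ AddSubgroup.card_addSubgroup_dvd_card B.ker
  obtain ⟨j, hj, hK⟩ := (Nat.dvd_prime_pow Nat.prime_two).1 hK
  rcases quad_sq g B hB with h | h
  · left; exact pow_eq_zero_iff (two_ne_zero) |>.1 h
  · right
    rw [hw, hK] at h
    set s := ∑ x, chi (g x)
    have h' : s.natAbs ^ 2 = 2 ^ (w + j) := by
      zify; rw [sq_abs, h]; push_cast; ring
    have : s.natAbs ∣ 2 ^ (w + j) := h' ▸ dvd_pow_self _ two_ne_zero
    obtain ⟨k, -, hk⟩ := (Nat.dvd_prime_pow Nat.prime_two).1 this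
    refine ⟨k, ?_, ?_⟩
    · rw [hk, ← pow_mul] at h'
      have := Nat.pow_right_injective le_rfl h'
      omega
    · rcases Int.natAbs_eq s with e | e
      · left; rw [e, hk]; simp
      · right; rw [e, hk]; simp

/-! ### Families of bounded rank -/

lemma fam_step {W : Type*} [AddCommGroup W] [Finite W] (S T : W →+ W →+ ZMod 2)
    (hS : ∀ x y, S x y = S y x) (hT : ∀ x y, T x y = T y x) (N : ℕ) (hN : 2 ≤ N)
    (hSN : S.ker.index = N) (hTN : T.ker.index ≤ N) (hSTN : (S + T).ker.index ≤ N) :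
    ((T.comp S.ker.subtype).compl₂ S.ker.subtype).ker.index < N := by
  set U := S.ker with hU
  set T' := (T.comp U.subtype).compl₂ U.subtype with hT'
  have h1 : T.ker.addSubgroupOf U ≤ T'.ker := by
    intro u hu
    rw [AddSubgroup.mem_addSubgroupOf, AddMonoidHom.mem_ker] at hu
    rw [AddMonoidHom.mem_ker]
    ext v
    simp [hT', hu]
  have h2 : T'.ker.index ≤ T.ker.relIndex U :=
    Nat.le_of_dvd (Nat.pos_of_ne_zero AddSubgroup.FiniteIndex.index_ne_zero)
      (AddSubgroup.index_dvd_of_le h1)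
  have h3 : T.ker.relIndex U ≤ T.ker.index :=
    Nat.le_of_dvd (Nat.pos_of_ne_zero AddSubgroup.FiniteIndex.index_ne_zero)
      (AddSubgroup.relIndex_dvd_index_of_normal _ _)
  by_contra hlt
  push Not at hlt
  have e1 : T.ker.relIndex U = N := by omega
  have e2 : T.ker.index = N := by omega
  have htop : U ⊔ T.ker = ⊤ := by
    have a := AddSubgroup.relIndex_sup_right (H := U) (K := T.ker)
    have b := AddSubgroup.relIndex_mul_index (H := T.ker) (K := U ⊔ T.ker) le_sup_right
    rw [a, e1, e2] at b
    rw [← AddSubgroup.index_eq_one]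
    exact Nat.eq_of_mul_eq_mul_left (by omega) (b.trans (mul_one N).symm)
  have hle : (S + T).ker ≤ T.ker ⊓ U := by
    intro x hx
    have hx' : ∀ y, S x y + T x y = 0 := fun y => by
      have : (S + T) x = 0 := hx
      simpa using DFunLike.congr_fun this y
    have hUx : ∀ y ∈ U, S x y = 0 := fun y hy => by
      rw [hS]; have : S y = 0 := hy
      simp [this]
    have hKx : ∀ y ∈ T.ker, T x y = 0 := fun y hy => by
      rw [hT]; have : T y = 0 := hy
      simp [this]
    have hz : ∀ y, S x y = 0 ∧ T x y = 0 := by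
      intro y
      have hy : y ∈ U ⊔ T.ker := htop ▸ AddSubgroup.mem_top y
      obtain ⟨u, hu, k, hk, rfl⟩ := AddSubgroup.mem_sup.1 hy
      have a1 := hUx u hu
      have a2 := hKx k hk
      have a3 := hx' u
      have a4 := hx' k
      rw [a1, zero_add] at a3
      rw [a2, add_zero] at a4
      simp [a1, a2, a3, a4]
    refine ⟨?_, ?_⟩
    · show T x = 0
      ext y; exact (hz y).2
    · show S x = 0
      ext y; exact (hz y).1
  have h5 : (T.ker ⊓ U).index = N * N := by
    have b := AddSubgroup.relIndex_mul_index (H := T.ker ⊓ U) (K := U) inf_le_right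
    rw [AddSubgroup.inf_relIndex_right, e1, hSN] at b
    exact b.symm
  have h6 : N * N ≤ (S + T).ker.index := h5 ▸
    Nat.le_of_dvd (Nat.pos_of_ne_zero AddSubgroup.FiniteIndex.index_ne_zero)
      (AddSubgroup.index_dvd_of_le hle)
  nlinarith

lemma fam (N : ℕ) : ∀ (H : Type) [Nonempty H] (W : Type) [AddCommGroup W] [Finite W]
    (T : H → W →+ W →+ ZMod 2), (∀ h x y, T h x y = T h y x) →
    (∀ a b, ∃ c, T c = T a + T b) → (∀ h, (T h).ker.index ≤ N) →
    ∃ U : AddSubgroup W, U.index ≤ N.factorial ∧ ∀ h, ∀ u ∈ U, ∀ v ∈ U, T h u v = 0 := by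
  induction N with
  | zero =>
    intro H hH W _ _ T _ _ hN
    obtain ⟨h⟩ := hH
    exact absurd (Nat.le_zero.1 (hN h)) AddSubgroup.FiniteIndex.index_ne_zero
  | succ N ih =>
    intro H hH W _ _ T hs hc hN
    by_cases hall : ∀ h, (T h).ker.index ≤ N
    · obtain ⟨U, hU, hU'⟩ := ih H W T hs hc hall
      exact ⟨U, hU.trans (Nat.factorial_le (Nat.le_succ N)), hU'⟩
    push Not at hall
    obtain ⟨h0, hh0⟩ := hall
    have hh0' : (T h0).ker.index = N + 1 := le_antisymm (hN h0) hh0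
    rcases Nat.eq_zero_or_pos N with rfl | hpos
    · refine ⟨⊤, by simp, fun h u _ v _ => ?_⟩
      have h1 : (T h).ker.index = 1 := by
        have := hN h
        have h3 : (T h).ker.index ≠ 0 := AddSubgroup.FiniteIndex.index_ne_zero
        omega
      rw [AddSubgroup.index_eq_one] at h1
      have : u ∈ (T h).ker := h1 ▸ AddSubgroup.mem_top u
      have h2 : T h u = 0 := this
      simp [h2]
    set U := (T h0).ker with hU
    obtain ⟨U', hU', hz⟩ := ih H U (fun h => ((T h).comp U.subtype).compl₂ U.subtype)
      (fun h x y => by simpa using hs h x y)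
      (fun a b => by
        obtain ⟨c, hc⟩ := hc a b
        refine ⟨c, ?_⟩
        ext x y
        simp [hc])
      (fun h => by
        obtain ⟨c, hc⟩ := hc h0 h
        have := fam_step (T h0) (T h) (hs h0) (hs h) (N + 1) (by omega) hh0' (hN h)
          (hc ▸ hN c)
        exact Nat.lt_succ_iff.1 this)
    refine ⟨U'.map U.subtype, ?_, ?_⟩
    · rw [AddSubgroup.index_map_subtype, hh0', Nat.factorial_succ, mul_comm]
      exact Nat.mul_le_mul_left _ hU'
    · rintro h _ ⟨u, hu, rfl⟩ _ ⟨v, hv, rfl⟩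
      simpa using hz h u hu v hv

/-! ### Sumsets -/

lemma sumset_stable {G : Type*} [AddCommGroup G] [Fintype G] [DecidableEq G]
    (h2 : ∀ x : G, x + x = 0) (P : ℕ → Finset G) (hmono : ∀ i, P i ⊆ P (i + 1))
    (hadd : ∀ i, ∀ a ∈ P i, ∀ b ∈ P i, a + b ∈ P (i + 1)) (k : ℕ)
    (h0 : 0 < (P 0).card) (hk : Fintype.card G ≤ k * (P 0).card) :
    ∃ i ≤ 3 * k, P (i + 1) = P i := by
  by_contra hcon
  push Not at hcon
  have hm : Monotone P := monotone_nat_of_le_succ hmono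
  have key : ∀ j, j ≤ k → (j + 1) * (P 0).card ≤ (P (3 * j)).card := by
    intro j
    induction j with
    | zero => intro _; simp
    | succ j ih =>
      intro hj
      have ih := ih (by omega)
      have hne := hcon (3 * j + 1) (by omega)
      obtain ⟨v, hv, hv'⟩ : ∃ v ∈ P (3 * j + 2), v ∉ P (3 * j + 1) := by
        by_contra hh
        push Not at hh
        exact hne (Finset.Subset.antisymm hh (hmono _))
      have hdis : Disjoint (P (3 * j)) ((P 0).image (v + ·)) := by
        rw [Finset.disjoint_left]
        intro x hx hx'
        obtain ⟨a, ha, rfl⟩ := Finset.mem_image.1 hx'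
        apply hv'
        have := hadd _ _ hx a (hm (Nat.zero_le _) ha)
        rwa [add_assoc, h2, add_zero] at this
      have hsub : P (3 * j) ∪ (P 0).image (v + ·) ⊆ P (3 * (j + 1)) := by
        apply Finset.union_subset (hm (by omega))
        intro x hx
        obtain ⟨a, ha, rfl⟩ := Finset.mem_image.1 hx
        exact hadd _ _ hv a (hm (Nat.zero_le _) ha)
      have := Finset.card_le_card hsub
      rw [Finset.card_union_of_disjoint hdis,
        Finset.card_image_of_injective _ (add_right_injective v)] at this
      linarith
  have h1 := key k le_rfl
  have h3 := Finset.card_le_univ (P (3 * k))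
  linarith

/-! ### Sums of signed powers of two -/

open scoped Pointwise in
def DS : Set ℝ := insert 0 (Set.range fun k : ℕ => (1 / 2 : ℝ) ^ k) ∪
  -(insert 0 (Set.range fun k : ℕ => (1 / 2 : ℝ) ^ k))

open scoped Pointwise in
lemma DS_compact : IsCompact DS := by
  have h : IsCompact (insert 0 (Set.range fun k : ℕ => (1 / 2 : ℝ) ^ k)) :=
    (tendsto_pow_atTop_nhds_zero_of_lt_one (by norm_num) (by norm_num)).isCompact_insert_range
  exact h.union h.neg

open scoped Pointwise in
def SS : ℕ → Set ℝ
  | 0 => {0}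
  | n + 1 => SS n + DS

open scoped Pointwise in
lemma SS_compact (n : ℕ) : IsCompact (SS n) := by
  induction n with
  | zero => exact isCompact_singleton
  | succ n ih => exact ih.add DS_compact

lemma zero_mem_DS : (0 : ℝ) ∈ DS := Or.inl (Or.inl rfl)

lemma DS_dyadic {x : ℝ} (hx : x ∈ DS) : ∃ (k : ℕ) (z : ℤ), x * 2 ^ k = z := by
  rcases hx with (rfl | ⟨k, rfl⟩) | h
  · exact ⟨0, 0, by simp⟩
  · refine ⟨k, 1, ?_⟩
    simp only []
    rw [← mul_pow]; norm_num
  · rcases h with h | ⟨k, hk⟩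
    · exact ⟨0, 0, by simpa using h⟩
    · refine ⟨k, -1, ?_⟩
      have : x = - (1 / 2 : ℝ) ^ k := by simp only [] at hk; linarith
      rw [this, neg_mul, ← mul_pow]; norm_num

lemma SS_dyadic (n : ℕ) : ∀ x ∈ SS n, ∃ (k : ℕ) (z : ℤ), x * 2 ^ k = z := by
  induction n with
  | zero => intro x hx; exact ⟨0, 0, by simpa [SS] using hx⟩
  | succ n ih =>
    rintro _ ⟨a, ha, b, hb, rfl⟩
    obtain ⟨k, z, h⟩ := ih a ha
    obtain ⟨k', z', h'⟩ := DS_dyadic hb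
    refine ⟨k + k', z * 2 ^ k' + z' * 2 ^ k, ?_⟩
    push_cast
    rw [← h, ← h']
    ring

lemma third_notMem (n : ℕ) : (1 / 3 : ℝ) ∉ SS n := by
  intro h
  obtain ⟨k, z, h⟩ := SS_dyadic n _ h
  have h1 : ((2 ^ k : ℕ) : ℤ) = 3 * z := by
    have : (2 : ℝ) ^ k = 3 * z := by linarith
    exact_mod_cast this
  have h2 : 3 ∣ 2 ^ k := by
    have : (3 : ℤ) ∣ ((2 ^ k : ℕ) : ℤ) := ⟨z, h1⟩
    exact_mod_cast this
  have := Nat.Prime.dvd_of_dvd_pow Nat.prime_three h2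
  omega

lemma SS_gap (n : ℕ) : ∃ δ > (0 : ℝ), ∀ x ∈ SS n, δ ≤ |x - 1 / 3| := by
  have ho : IsOpen (SS n)ᶜ := (SS_compact n).isClosed.isOpen_compl
  obtain ⟨δ, hδ, hb⟩ := Metric.isOpen_iff.1 ho _ (third_notMem n)
  refine ⟨δ, hδ, fun x hx => ?_⟩
  by_contra hlt
  push Not at hlt
  exact hb (by rwa [Metric.mem_ball, Real.dist_eq]) hx

open scoped Pointwise in
lemma SS_mono : Monotone SS := monotone_nat_of_le_succ fun n x hx =>
  ⟨x, hx, 0, zero_mem_DS, by simp⟩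

open scoped Pointwise in
lemma sum_mem_SS {ι : Type*} (s : Finset ι) (t : ι → ℝ) (h : ∀ i ∈ s, t i ∈ DS) :
    ∑ i ∈ s, t i ∈ SS s.card := by
  classical
  induction s using Finset.induction_on with
  | empty => simp [SS]
  | insert a s ha ih =>
    rw [Finset.sum_insert ha, Finset.card_insert_of_notMem ha, add_comm (t a)]
    exact ⟨_, ih fun i hi => h i (Finset.mem_insert_of_mem hi), _,
      h a (Finset.mem_insert_self a s), rfl⟩

/-! ### Derivatives -/

def Dv {G : Type*} [AddCommGroup G] (a : G) (f : G → ZMod 2) (x : G) : ZMod 2 := f (x + a) + f x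

def LowDeg {G : Type*} [AddCommGroup G] : ℕ → (G → ZMod 2) → Prop
  | 0, f => ∀ x, f x = 0
  | n + 1, f => ∀ a, LowDeg n (Dv a f)

section
variable {G : Type*} [AddCommGroup G]

lemma LowDeg.add {n : ℕ} : ∀ {f g : G → ZMod 2}, LowDeg n f → LowDeg n g →
    LowDeg n (fun x => f x + g x) := by
  induction n with
  | zero => intro f g hf hg x; simp [hf x, hg x]
  | succ n ih =>
    intro f g hf hg a
    have := ih (hf a) (hg a)
    convert this using 1
    funext x; simp only [Dv]; ring

lemma LowDeg.zero (n : ℕ) : LowDeg n (fun _ : G => 0) := by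
  induction n with
  | zero => intro x; rfl
  | succ n ih => intro a; convert ih using 1; funext x; simp [Dv]

lemma LowDeg.smul {n : ℕ} (c : ZMod 2) : ∀ {f : G → ZMod 2}, LowDeg n f →
    LowDeg n (fun x => c * f x) := by
  induction n with
  | zero => intro f hf x; simp [hf x]
  | succ n ih =>
    intro f hf a
    have := ih (hf a)
    convert this using 1
    funext x; simp only [Dv]; ring

lemma LowDeg.succ {n : ℕ} : ∀ {f : G → ZMod 2}, LowDeg n f → LowDeg (n + 1) f := by
  induction n with
  | zero => intro f hf a x; simp [Dv, hf x, hf (x + a)]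
  | succ n ih => intro f hf a; exact ih (hf a)

lemma LowDeg.mono {n k : ℕ} (h : n ≤ k) {f : G → ZMod 2} (hf : LowDeg n f) : LowDeg k f := by
  induction h with
  | refl => exact hf
  | step _ ih => exact ih.succ

lemma LowDeg.sum {ι : Type*} {n : ℕ} (s : Finset ι) (f : ι → G → ZMod 2)
    (h : ∀ i ∈ s, LowDeg n (f i)) : LowDeg n (fun x => ∑ i ∈ s, f i x) := by
  classical
  induction s using Finset.induction_on with
  | empty => simpa using LowDeg.zero n
  | insert a s ha ih =>
    simp_rw [Finset.sum_insert ha]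
    exact (h a (Finset.mem_insert_self a s)).add
      (ih fun i hi => h i (Finset.mem_insert_of_mem hi))

lemma LowDeg.mul_hom {n : ℕ} (l : G → ZMod 2) (hl : ∀ x y, l (x + y) = l x + l y) :
    ∀ {f : G → ZMod 2}, LowDeg n f → LowDeg (n + 1) (fun x => l x * f x) := by
  induction n with
  | zero => intro f hf; exact LowDeg.succ (fun x => by simp [hf x])
  | succ n ih =>
    intro f hf a
    have h1 := (ih (hf a)).add (((hf a).succ.smul (l a)).add (hf.smul (l a)))
    convert h1 using 1
    funext x
    simp only [Dv, hl]
    have := z2_self (l a * f x)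
    linear_combination (-1 : ZMod 2) * this
end

lemma lowDeg_monomial {m : ℕ} (s : Fin m →₀ ℕ) :
    LowDeg (s.sum (fun _ e => e) + 1) (fun x : Fin m → ZMod 2 => s.prod fun i e => x i ^ e) := by
  classical
  have hmul : ∀ (i : Fin m) (e n : ℕ) (f : (Fin m → ZMod 2) → ZMod 2), LowDeg n f →
      LowDeg (e + n) (fun x => x i ^ e * f x) := by
    intro i e n f hf
    induction e with
    | zero => simpa using hf
    | succ e ih =>
      have := LowDeg.mul_hom (fun x : Fin m → ZMod 2 => x i) (fun _ _ => rfl) ih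
      convert this using 1
      · omega
      · funext x; ring
  induction s using Finsupp.induction with
  | zero => intro a x; simp [Dv]; decide
  | single_add i e s hi he ih =>
    have := hmul i e _ _ ih
    convert this using 1
    · rw [Finsupp.sum_add_index' (by simp) (by simp), Finsupp.sum_single_index rfl]; ring
    · funext x
      rw [Finsupp.prod_add_index' (by simp) (by intros; rw [pow_add]),
        Finsupp.prod_single_index (by simp)]

lemma lowDeg_of_degLE {m d : ℕ} {Q : (Fin m → ZMod 2) → ZMod 2} (h : DegLE d Q) :
    LowDeg (d + 1) Q := by
  obtain ⟨p, hp, hQ⟩ := h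
  have : Q = fun x => ∑ s ∈ p.support, p.coeff s * s.prod fun i e => x i ^ e := by
    funext x
    rw [← hQ x, MvPolynomial.eval_eq]
    rfl
  rw [this]
  refine LowDeg.sum _ _ fun s hs => ?_
  refine LowDeg.smul _ (LowDeg.mono ?_ (lowDeg_monomial s))
  have := MvPolynomial.le_totalDegree hs
  omega

section
variable {G : Type} [AddCommGroup G]

lemma Dv_comm (a b : G) (f : G → ZMod 2) : Dv a (Dv b f) = Dv b (Dv a f) := by
  funext x
  simp only [Dv]
  rw [add_right_comm x a b]; ring

lemma Dv_add_dir (a b : G) (f : G → ZMod 2) (x : G) :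
    Dv (a + b) f x = Dv a f x + Dv b f x + Dv a (Dv b f) x := by
  simp only [Dv]
  rw [← add_assoc]
  have h1 := z2_self (f (x + a))
  have h2 := z2_self (f (x + b))
  have h3 := z2_self (f x)
  linear_combination (-1 : ZMod 2) * (h1 + h2 + h3)

def TF (f : G → ZMod 2) (a b c : G) : ZMod 2 := Dv a (Dv b (Dv c f)) 0

variable {f : G → ZMod 2}

lemma TF_const (h4 : LowDeg 4 f) (a b c x : G) : Dv a (Dv b (Dv c f)) x = TF f a b c := by
  have := h4 c b a x 0
  simp only [Dv.eq_1 x, zero_add] at this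
  have h2 := z2_self (TF f a b c)
  unfold TF at h2 ⊢
  linear_combination this - h2

lemma TF_comm1 (a b c : G) : TF f a b c = TF f b a c := by
  unfold TF; rw [Dv_comm]

lemma TF_comm2 (a b c : G) : TF f a b c = TF f a c b := by
  unfold TF; rw [Dv_comm b c]

lemma TF_add1 (h4 : LowDeg 4 f) (a a' b c : G) : TF f (a + a') b c = TF f a b c + TF f a' b c := by
  unfold TF
  rw [Dv_add_dir]
  have := h4 c b a' a 0
  rw [this, add_zero]

lemma TF_add2 (h4 : LowDeg 4 f) (a b b' c : G) : TF f a (b + b') c = TF f a b c + TF f a b' c := by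
  rw [TF_comm1, TF_add1 h4, TF_comm1 b, TF_comm1 b']

lemma TF_add3 (h4 : LowDeg 4 f) (a b c c' : G) : TF f a b (c + c') = TF f a b c + TF f a b c' := by
  rw [TF_comm2, TF_add2 h4, TF_comm2 a c, TF_comm2 a c']

def TT (h4 : LowDeg 4 f) (a : G) : G →+ G →+ ZMod 2 :=
  AddMonoidHom.mk' (fun b => AddMonoidHom.mk' (fun c => TF f a b c) (TF_add3 h4 a b))
    (fun b b' => by ext c; exact TF_add2 h4 a b b' c)

lemma TT_apply (h4 : LowDeg 4 f) (a b c : G) : TT h4 a b c = TF f a b c := rfl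

lemma TT_add (h4 : LowDeg 4 f) (a b : G) : TT h4 (a + b) = TT h4 a + TT h4 b := by
  ext x y; exact TF_add1 h4 a b x y

lemma Dv_quad (h4 : LowDeg 4 f) (a x y : G) :
    Dv a f (x + y) = Dv a f x + Dv a f y + Dv a f 0 + TT h4 a x y := by
  rw [TT_apply, TF_comm1, TF_comm2]
  unfold TF
  generalize Dv a f = g
  simp only [Dv, zero_add]
  have h1 := z2_self (g x)
  have h2 := z2_self (g y)
  have h3 := z2_self (g 0)
  linear_combination (-1 : ZMod 2) * (h1 + h2 + h3)

lemma sq_eq_sum_Dv [Fintype G] (f : G → ZMod 2) :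
    (∑ x, chi (f x)) ^ 2 = ∑ a, ∑ x, chi (Dv a f x) := by
  rw [sq, Finset.sum_mul_sum, Finset.sum_comm (s := Finset.univ (α := G)) (f := fun a x => chi (Dv a f x))]
  refine Finset.sum_congr rfl fun x _ => ?_
  rw [← Equiv.sum_comp (Equiv.addLeft x) (fun y => chi (f x) * chi (f y))]
  refine Finset.sum_congr rfl fun h _ => ?_
  rw [Dv, chi_add, mul_comm]; rfl

lemma abs_sum_chi_le {A : Type*} [Fintype A] (g : A → ZMod 2) :
    ∑ x, chi (g x) ≤ (Fintype.card A : ℤ) := by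
  have : ∀ a, chi a ≤ 1 := by decide
  calc ∑ x, chi (g x) ≤ ∑ _x : A, (1 : ℤ) := Finset.sum_le_sum fun x _ => this _
    _ = _ := by simp

open Classical in
lemma dens [Fintype G] (h4 : LowDeg 4 f) (hS : (Fintype.card G : ℤ) ≤ 4 * ∑ x, chi (f x)) :
    Fintype.card G ≤ 32 * (Finset.univ.filter fun a => (TT h4 a).ker.index ≤ 1024).card := by
  obtain ⟨n, hn⟩ : ∃ n : ℤ, n = (Fintype.card G : ℤ) := ⟨_, rfl⟩
  rw [← hn] at hS
  have hnpos : 0 < n := by rw [hn]; exact_mod_cast Fintype.card_pos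
  set A := Finset.univ.filter fun a => (TT h4 a).ker.index ≤ 1024 with hA
  have hbound : ∀ a, 32 * ∑ x, chi (Dv a f x) ≤ (if a ∈ A then 32 * n else 0) + n := by
    intro a
    split_ifs with ha
    · have := abs_sum_chi_le (Dv a f)
      linarith
    · have hidx : 1024 < (TT h4 a).ker.index := by simpa [hA] using ha
      set s := ∑ x, chi (Dv a f x) with hs
      have hc := AddSubgroup.card_mul_index (TT h4 a).ker
      have hc' : (Nat.card (TT h4 a).ker : ℤ) * ((TT h4 a).ker.index : ℤ) = n := by
        rw [hn, ← Nat.card_eq_fintype_card]; exact_mod_cast hc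
      have hidx' : (1024 : ℤ) ≤ ((TT h4 a).ker.index : ℤ) := by exact_mod_cast hidx.le
      have hk0 : (0 : ℤ) ≤ (Nat.card (TT h4 a).ker : ℤ) := by positivity
      have hsq : s ^ 2 ≤ n * (Nat.card (TT h4 a).ker : ℤ) := by
        rcases quad_sq (Dv a f) (TT h4 a) (Dv_quad h4 a) with h | h
        · rw [hs, h]; positivity
        · rw [hs, h, Nat.card_eq_fintype_card (α := G), hn]
      have h3 : 1024 * (Nat.card (TT h4 a).ker : ℤ) ≤ n := by nlinarith
      have h5 : (32 * s) ^ 2 ≤ n ^ 2 := by nlinarith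
      have := abs_le_of_sq_le_sq' h5 hnpos.le
      linarith [this.2]
  have hsum : 32 * (∑ x, chi (f x)) ^ 2 ≤ 32 * n * A.card + n * n := by
    rw [sq_eq_sum_Dv, Finset.mul_sum]
    refine (Finset.sum_le_sum fun a _ => hbound a).trans ?_
    rw [Finset.sum_add_distrib, Finset.sum_ite_mem]
    simp only [Finset.univ_inter, Finset.sum_const, Finset.card_univ, nsmul_eq_mul, ← hn]
    linarith
  have h1 : n ^ 2 ≤ (4 * ∑ x, chi (f x)) ^ 2 := pow_le_pow_left₀ hnpos.le hS 2
  have h2 : n * n ≤ n * (32 * A.card) := by nlinarith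
  have := le_of_mul_le_mul_left h2 hnpos
  rw [hn] at this
  exact_mod_cast this

def Mi (i : ℕ) : ℕ := 1024 ^ (2 ^ i)

lemma Mi_succ (i : ℕ) : Mi (i + 1) = Mi i * Mi i := by
  unfold Mi; rw [pow_succ, pow_mul, sq]

lemma Mi_pos (i : ℕ) : 0 < Mi i := by unfold Mi; positivity

lemma Mi_mono : Monotone Mi := monotone_nat_of_le_succ fun i => by
  rw [Mi_succ]; exact Nat.le_mul_of_pos_left _ (Mi_pos i)

lemma Mi_zero : Mi 0 = 1024 := by simp [Mi]

def bigK (k : ℕ) : ℕ := (Mi (3 * k)).factorial * k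

lemma structure_aux [Fintype G] (h2 : ∀ x : G, x + x = 0) (h4 : LowDeg 4 f) (k : ℕ)
    (hk : ∀ A : Finset G, (∀ a, a ∈ A ↔ (TT h4 a).ker.index ≤ Mi 0) →
      Fintype.card G ≤ k * A.card) :
    ∃ W : AddSubgroup G, W.index ≤ bigK k ∧
      ∀ a ∈ W, ∀ b ∈ W, ∀ c ∈ W, TF f a b c = 0 := by
  classical
  set P : ℕ → Finset G := fun i => Finset.univ.filter fun a => (TT h4 a).ker.index ≤ Mi i with hP
  have hmem : ∀ i a, a ∈ P i ↔ (TT h4 a).ker.index ≤ Mi i := by simp [hP]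
  have hzero : ∀ i, (0 : G) ∈ P i := by
    intro i
    rw [hmem]
    have : TT h4 0 = 0 := by
      have := TT_add h4 0 0
      simpa using this
    rw [this]
    have : (0 : G →+ G →+ ZMod 2).ker = ⊤ := by ext; simp
    rw [this, AddSubgroup.index_top]
    exact Mi_pos i
  have hmono : ∀ i, P i ⊆ P (i + 1) := fun i a ha => by
    rw [hmem] at ha ⊢; exact ha.trans (Mi_mono (Nat.le_succ i))
  have hadd : ∀ i, ∀ a ∈ P i, ∀ b ∈ P i, a + b ∈ P (i + 1) := by
    intro i a ha b hb
    rw [hmem] at ha hb ⊢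
    have hle : (TT h4 a).ker ⊓ (TT h4 b).ker ≤ (TT h4 (a + b)).ker := by
      rintro x ⟨hx, hy⟩
      have hx' : TT h4 a x = 0 := hx
      have hy' : TT h4 b x = 0 := hy
      show TT h4 (a + b) x = 0
      rw [TT_add, AddMonoidHom.add_apply, hx', hy', add_zero]
    calc _ ≤ ((TT h4 a).ker ⊓ (TT h4 b).ker).index :=
          Nat.le_of_dvd (Nat.pos_of_ne_zero AddSubgroup.FiniteIndex.index_ne_zero)
            (AddSubgroup.index_dvd_of_le hle)
      _ ≤ _ := AddSubgroup.index_inf_le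
      _ ≤ _ := by rw [Mi_succ]; exact Nat.mul_le_mul ha hb
  have hkP := hk (P 0) (hmem 0)
  obtain ⟨i, hi, hst⟩ := sumset_stable h2 P hmono hadd k (Finset.card_pos.2 ⟨0, hzero 0⟩) hkP
  have hneg : ∀ x : G, -x = x := fun x => neg_eq_of_add_eq_zero_left (h2 x)
  let V : AddSubgroup G :=
    { carrier := (P i : Set G)
      zero_mem' := hzero i
      add_mem' := fun {a b} ha hb => by
        have := hadd i a ha b hb
        rw [hst] at this; exact this
      neg_mem' := fun {a} ha => by rw [hneg]; exact ha }
  have hVmem : ∀ a, a ∈ V ↔ a ∈ P i := fun a => Iff.rfl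
  have hVidx : V.index ≤ k := by
    have hcard : Nat.card V = (P i).card := by
      have : Nat.card (P i) = (P i).card := by simp
      exact this
    have h1 := AddSubgroup.card_mul_index V
    have hm : (P 0).card ≤ (P i).card :=
      Finset.card_le_card (monotone_nat_of_le_succ (f := P) hmono (Nat.zero_le i))
    have hpos : 0 < (P i).card := Finset.card_pos.2 ⟨0, hzero i⟩
    rw [hcard, Nat.card_eq_fintype_card] at h1
    have : (P i).card * V.index ≤ (P i).card * k := by
      rw [h1]; nlinarith
    exact Nat.le_of_mul_le_mul_left this hpos
  obtain ⟨U, hU, hUz⟩ := fam (Mi i) V G (fun a => TT h4 a) (fun h x y => TF_comm2 _ _ _)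
    (fun a b => ⟨a + b, TT_add h4 a b⟩) (fun h => (hmem i h).1 h.2)
  refine ⟨U ⊓ V, ?_, ?_⟩
  · refine (AddSubgroup.index_inf_le).trans ?_
    exact Nat.mul_le_mul (hU.trans (Nat.factorial_le (Mi_mono hi))) hVidx
  · intro a ha b hb c hc
    exact hUz ⟨a, ha.2⟩ b hb.1 c hc.1

lemma structure_main [Fintype G] (h2 : ∀ x : G, x + x = 0) (h4 : LowDeg 4 f)
    (hS : (Fintype.card G : ℤ) ≤ 4 * ∑ x, chi (f x)) :
    ∃ W : AddSubgroup G, W.index ≤ bigK 32 ∧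
      ∀ a ∈ W, ∀ b ∈ W, ∀ c ∈ W, TF f a b c = 0 := by
  classical
  refine structure_aux h2 h4 32 fun A hA => ?_
  have := dens h4 hS
  convert this using 3
  ext a
  rw [hA, Mi_zero]; simp

lemma coset_val [Fintype G] (h4 : LowDeg 4 f) (W : AddSubgroup G) [Fintype W]
    (hW : ∀ a ∈ W, ∀ b ∈ W, ∀ c ∈ W, TF f a b c = 0) (x0 : G) {m : ℕ}
    (hm : Nat.card G = 2 ^ m) :
    ∑ w : W, chi (f (x0 + w)) = 0 ∨ ∃ k ≤ m, ∑ w : W, chi (f (x0 + w)) = 2 ^ k ∨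
      ∑ w : W, chi (f (x0 + w)) = - 2 ^ k := by
  have hadd : ∀ a ∈ W, ∀ a' ∈ W, ∀ b ∈ W,
      Dv (a + a') (Dv b f) x0 = Dv a (Dv b f) x0 + Dv a' (Dv b f) x0 := by
    intro a ha a' ha' b hb
    rw [Dv_add_dir, TF_const h4, hW a ha a' ha' b hb, add_zero]
  let B : W →+ W →+ ZMod 2 :=
    AddMonoidHom.mk' (fun a => AddMonoidHom.mk' (fun b => Dv (a : G) (Dv (b : G) f) x0)
      (fun b b' => by
        rw [Dv_comm, AddSubgroup.coe_add, hadd b b.2 b' b'.2 a a.2, Dv_comm, Dv_comm (b' : G)]))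
      (fun a a' => by ext b; exact hadd a a.2 a' a'.2 b b.2)
  refine quad_val (fun w : W => f (x0 + w)) B (fun x y => ?_)
    (hm ▸ AddSubgroup.card_addSubgroup_dvd_card W)
  show f (x0 + (x + y : G)) = f (x0 + x) + f (x0 + y) + f (x0 + (0 : G)) +
    Dv (x : G) (Dv (y : G) f) x0
  simp only [Dv, add_zero, ← add_assoc]
  have h1 := z2_self (f (x0 + x))
  have h2 := z2_self (f (x0 + y))
  have h3 := z2_self (f x0)
  linear_combination (-1 : ZMod 2) * (h1 + h2 + h3)

lemma mem_DS_of {s : ℤ} {m : ℕ} (h : s = 0 ∨ ∃ k ≤ m, s = 2 ^ k ∨ s = - 2 ^ k) :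
    (s : ℝ) / 2 ^ m ∈ DS := by
  have hp : ∀ k ≤ m, (2 : ℝ) ^ k / 2 ^ m = (1 / 2) ^ (m - k) := by
    intro k hk
    rw [one_div, inv_pow, div_eq_iff (by positivity), inv_mul_eq_div, eq_div_iff (by positivity),
      ← pow_add]
    congr 1; omega
  rcases h with rfl | ⟨k, hk, rfl | rfl⟩
  · simpa using zero_mem_DS
  · push_cast
    rw [hp k hk]
    exact Or.inl (Or.inr ⟨_, rfl⟩)
  · push_cast
    rw [neg_div, hp k hk]
    right
    rw [Set.mem_neg, neg_neg]
    exact Or.inr ⟨_, rfl⟩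

lemma bias_mem [Fintype G] {C : ℕ} (hC : bigK 32 ≤ C) (h2 : ∀ x : G, x + x = 0) (h4 : LowDeg 4 f) {m : ℕ}
    (hm : Nat.card G = 2 ^ m) (hS : (Fintype.card G : ℤ) ≤ 4 * ∑ x, chi (f x)) :
    ((∑ x, chi (f x) : ℤ) : ℝ) / 2 ^ m ∈ SS C := by
  classical
  obtain ⟨W, hidx, hW⟩ := structure_main h2 h4 hS
  have : Fintype (G ⧸ W) := Fintype.ofFinite _
  have e1 : ∑ x, chi (f x) = ∑ c : G ⧸ W, ∑ w : W, chi (f (c.out + w)) := by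
    rw [← Finset.sum_fiberwise (Finset.univ) (fun x : G => (x : G ⧸ W)) (fun x => chi (f x))]
    refine Finset.sum_congr rfl fun c _ => ?_
    symm
    refine Finset.sum_bij (fun (w : W) _ => c.out + (w : G)) ?_ ?_ ?_ ?_
    · intro w _
      simp
    · intro w _ w' _ h
      exact Subtype.ext (add_left_cancel h)
    · intro x hx
      have hx' : (x : G ⧸ W) = c := by simpa using hx
      refine ⟨⟨-c.out + x, ?_⟩, Finset.mem_univ _, by simp⟩
      rw [← QuotientAddGroup.eq, hx']
      exact QuotientAddGroup.out_eq' c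
    · intro w _; rfl
  rw [e1]
  push_cast
  rw [Finset.sum_div]
  have h := sum_mem_SS (Finset.univ : Finset (G ⧸ W))
    (fun c => (∑ w : W, (chi (f (c.out + w)) : ℝ)) / 2 ^ m) (fun c _ => by
      have := mem_DS_of (coset_val h4 W hW c.out hm)
      push_cast at this
      exact this)
  refine SS_mono ?_ h
  rw [Finset.card_univ, ← Nat.card_eq_fintype_card]
  exact hidx.trans hC
end

lemma bias_prOne {m : ℕ} (Q : (Fin m → ZMod 2) → ZMod 2) :
    ((∑ x, chi (Q x) : ℤ) : ℝ) / 2 ^ m = 1 - 2 * prOne Q := by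
  have hc : ∀ a : ZMod 2, chi a = 1 - 2 * (if a = 1 then 1 else 0) := by decide
  have e : ∑ x, chi (Q x) = 2 ^ m - 2 * ((Finset.univ.filter fun x => Q x = 1).card : ℤ) := by
    simp_rw [hc]
    rw [Finset.sum_sub_distrib, ← Finset.mul_sum, Finset.sum_boole]
    simp [ZMod.card]
  rw [e]
  unfold prOne distOf
  have : (Fintype.card (Fin m → ZMod 2) : ℝ) = 2 ^ m := by simp [ZMod.card]
  rw [this]
  push_cast
  field_simp

/-- every cubic polynomial is at constant distance from `Ber(1/3)`. -/
theorem cubic_gap :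
    ∃ δ₃ > (0:ℝ), ∀ m : ℕ, ∀ Q : (Fin m → ZMod 2) → ZMod 2,
      DegLE 3 Q → |prOne Q - 1/3| ≥ δ₃ := by
  obtain ⟨C, hC⟩ : ∃ C, bigK 32 ≤ C := ⟨_, le_rfl⟩
  obtain ⟨δ, hδ, hgap⟩ := SS_gap C
  refine ⟨min (1 / 24) (δ / 2), by positivity, fun m Q hQ => ?_⟩
  have h4 : LowDeg 4 Q := lowDeg_of_degLE hQ
  have hb := bias_prOne Q
  by_contra hlt
  push Not at hlt
  obtain ⟨h1, h3⟩ := lt_min_iff.1 hlt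
  have hcard : Fintype.card (Fin m → ZMod 2) = 2 ^ m := by simp [ZMod.card]
  have hS : (Fintype.card (Fin m → ZMod 2) : ℤ) ≤ 4 * ∑ x, chi (Q x) := by
    rw [hcard]
    have hpos : (0 : ℝ) < 2 ^ m := by positivity
    have h5 := (abs_lt.1 h1).2
    have h6 : (1 / 4 : ℝ) ≤ ((∑ x, chi (Q x) : ℤ) : ℝ) / 2 ^ m := by rw [hb]; linarith
    rw [le_div_iff₀ hpos] at h6
    have h7 : (2 : ℝ) ^ m ≤ 4 * ((∑ x, chi (Q x) : ℤ) : ℝ) := by linarith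
    exact_mod_cast h7
  have hmem := bias_mem hC (fun x => by funext i; exact z2_self (x i)) h4
    (by rw [Nat.card_eq_fintype_card, hcard]) hS
  have h8 := hgap _ hmem
  rw [hb] at h8
  have h9 : (1 - 2 * prOne Q - 1 / 3 : ℝ) = -(2 * (prOne Q - 1 / 3)) := by ring
  rw [h9, abs_neg, abs_mul, abs_two] at h8
  linarith
end

section
/- Let ρ ∈ (0,1) be a non-dyadic real number, i.e., ρ is not of the form a/2^b for integers a and b ≥ 0. Then for every positive integer d there exists a constant c > 0 (depending only on d and ρ) such that for every m and every function P : 𝔽₂^m → 𝔽₂ of degree at most d, |Pr_{X ~ Unif(𝔽₂^m)}[P(X) = 1] − ρ| ≥ c. -/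
open Finset

open MeasureTheory

namespace NDG

lemma z2 (a : ZMod 2) : a = 0 ∨ a = 1 := by revert a; decide

/-- measurability of a `ZMod 2`-valued function -/
def MZ {Ω : Type*} (m : MeasurableSpace Ω) (P : Ω → ZMod 2) : Prop := MeasurableSet[m] {x | P x = 1}

section mz
variable {Ω : Type*} {m : MeasurableSpace Ω}

lemma MZ.zero_set {P : Ω → ZMod 2} (h : MZ m P) : MeasurableSet[m] {x | P x = 0} := by
  have : {x | P x = 0} = {x | P x = 1}ᶜ := by
    ext x; simp only [Set.mem_ofPred_eq, Set.mem_compl_iff]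
    rcases z2 (P x) with h | h <;> simp [h]
  rw [this]; exact MeasurableSet.compl h

lemma MZ.add {P Q : Ω → ZMod 2} (h : MZ m P) (h' : MZ m Q) : MZ m (fun x => P x + Q x) := by
  have : {x | P x + Q x = 1} = ({x | P x = 1} ∩ {x | Q x = 0}) ∪ ({x | P x = 0} ∩ {x | Q x = 1}) := by
    ext x; simp only [Set.mem_ofPred_eq, Set.mem_union, Set.mem_inter_iff]
    generalize P x = a; generalize Q x = b; revert a b; decide
  unfold MZ
  rw [this]
  exact (h.inter h'.zero_set).union (h.zero_set.inter h')

lemma MZ.mul {P Q : Ω → ZMod 2} (h : MZ m P) (h' : MZ m Q) : MZ m (fun x => P x * Q x) := by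
  have : {x | P x * Q x = 1} = ({x | P x = 1} ∩ {x | Q x = 1}) := by
    ext x; simp only [Set.mem_ofPred_eq, Set.mem_inter_iff]
    generalize P x = a; generalize Q x = b; revert a b; decide
  unfold MZ
  rw [this]
  exact (h.inter h')

lemma MZ.zero : MZ m (fun _ : Ω => 0) := by simp [MZ]

lemma MZ.eq_set {P Q : Ω → ZMod 2} (h : MZ m P) (h' : MZ m Q) : MeasurableSet[m] {x | P x = Q x} := by
  have : {x | P x = Q x} = {x | P x + Q x = 0} := by
    ext x; simp only [Set.mem_ofPred_eq]
    generalize P x = a; generalize Q x = b; revert a b; decide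
  rw [this]; exact (h.add h').zero_set

lemma MZ.mono {m' : MeasurableSpace Ω} (hm : m ≤ m') {P : Ω → ZMod 2} (h : MZ m P) : MZ m' P := hm _ h

open Classical in
/-- indicator with values in `ZMod 2` -/
noncomputable def ind (A : Set Ω) : Ω → ZMod 2 := fun x => if x ∈ A then 1 else 0

lemma ind_eq_one (A : Set Ω) : {x | ind A x = 1} = A := by
  ext x; by_cases h : x ∈ A <;> simp [ind, h]

lemma mz_ind {A : Set Ω} (hA : MeasurableSet[m] A) : MZ m (ind A) := by
  unfold MZ; rw [ind_eq_one]; exact hA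

end mz

section sg
variable {Ω : Type*}

/-- the sigma-algebra generated by a family of functions -/
@[reducible] def sig (M : Set (Ω → ZMod 2)) : MeasurableSpace Ω :=
  MeasurableSpace.generateFrom {A | ∃ Q ∈ M, A = {x | Q x = 1}}

lemma sig_le {M : Set (Ω → ZMod 2)} {m : MeasurableSpace Ω} (h : ∀ Q ∈ M, MZ m Q) : sig M ≤ m := by
  apply MeasurableSpace.generateFrom_le
  rintro _ ⟨Q, hQ, rfl⟩
  exact h Q hQ

lemma mz_sig {M : Set (Ω → ZMod 2)} {Q : Ω → ZMod 2} (h : Q ∈ M) : MZ (sig M) Q :=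
  MeasurableSpace.measurableSet_generateFrom ⟨Q, h, rfl⟩

lemma sig_mono {M N : Set (Ω → ZMod 2)} (h : M ⊆ N) : sig M ≤ sig N :=
  sig_le fun _ hQ => mz_sig (h hQ)

end sg

variable {Ω G : Type*} [m0 : MeasurableSpace Ω] (μ : Measure Ω) (T : G → Ω → Ω)

/-- phase polynomials of degree `< d` -/
def Pol : ℕ → (Ω → ZMod 2) → Prop
  | 0, P => MZ m0 P ∧ ∀ᵐ x ∂μ, P x = 0
  | (d+1), P => MZ m0 P ∧ ∀ h, Pol d (fun x => P (T h x) + P x)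

variable {μ T}

lemma Pol.mz {d : ℕ} {P : Ω → ZMod 2} (h : Pol μ T d P) : MZ m0 P := by
  cases d <;> exact h.1

lemma MZ.compT (hT : ∀ h, MeasurePreserving (T h) μ μ) {P : Ω → ZMod 2} (h : MZ m0 P) (g : G) :
    MZ m0 (fun x => P (T g x)) := (hT g).measurable h

lemma Pol.succ (hT : ∀ h, MeasurePreserving (T h) μ μ) {d : ℕ} :
    ∀ {P : Ω → ZMod 2}, Pol μ T d P → Pol μ T (d+1) P := by
  induction d with
  | zero =>
    intro P h
    refine ⟨h.1, fun g => ⟨(h.1.compT hT g).add h.1, ?_⟩⟩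
    filter_upwards [h.2, (hT g).quasiMeasurePreserving.ae h.2] with x h1 h2
    simp [h1, h2]
  | succ d ih =>
    intro P h
    exact ⟨h.1, fun g => ih (h.2 g)⟩

lemma Pol.mono (hT : ∀ h, MeasurePreserving (T h) μ μ) {d e : ℕ} (hde : d ≤ e)
    {P : Ω → ZMod 2} (h : Pol μ T d P) : Pol μ T e P := by
  induction hde with
  | refl => exact h
  | step _ ih => exact ih.succ hT

lemma Pol.add {d : ℕ} : ∀ {P Q : Ω → ZMod 2}, Pol μ T d P → Pol μ T d Q →
    Pol μ T d (fun x => P x + Q x) := by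
  induction d with
  | zero =>
    intro P Q h h'
    refine ⟨h.1.add h'.1, ?_⟩
    filter_upwards [h.2, h'.2] with x h1 h2
    simp [h1, h2]
  | succ d ih =>
    intro P Q h h'
    refine ⟨h.1.add h'.1, fun g => ?_⟩
    have := ih (h.2 g) (h'.2 g)
    convert this using 2
    ring

lemma Pol.zero {d : ℕ} : Pol μ T d (fun _ => 0) := by
  induction d with
  | zero => exact ⟨MZ.zero, by simp⟩
  | succ d ih => exact ⟨MZ.zero, fun g => by simpa using ih⟩

lemma Pol.compT (hT : ∀ h, MeasurePreserving (T h) μ μ) {d : ℕ} {P : Ω → ZMod 2}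
    (h : Pol μ T d P) (g : G) : Pol μ T d (fun x => P (T g x)) := by
  have h1 := (h.succ hT).2 g
  have := h1.add h
  convert this using 2
  rw [add_assoc, CharTwo.add_self_eq_zero, add_zero]

lemma Pol.mul (hT : ∀ h, MeasurePreserving (T h) μ μ) : ∀ (n a b : ℕ), a + b = n →
    ∀ {P Q : Ω → ZMod 2}, Pol μ T a P → Pol μ T b Q →
    Pol μ T n (fun x => P x * Q x) := by
  intro n
  induction n with
  | zero =>
    intro a b hab P Q hP hQ
    obtain rfl : a = 0 := by omega
    refine ⟨hP.mz.mul hQ.mz, ?_⟩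
    filter_upwards [hP.2] with x h1
    simp [h1]
  | succ n ih =>
    intro a b hab P Q hP hQ
    cases a with
    | zero =>
      refine Pol.mono hT (Nat.zero_le _) ⟨hP.mz.mul hQ.mz, ?_⟩
      filter_upwards [hP.2] with x h1
      simp [h1]
    | succ a =>
      cases b with
      | zero =>
        refine Pol.mono hT (Nat.zero_le _) ⟨hP.mz.mul hQ.mz, ?_⟩
        filter_upwards [hQ.2] with x h1
        simp [h1]
      | succ b =>
        refine ⟨hP.mz.mul hQ.mz, fun g => ?_⟩
        have h1 := ih a (b+1) (by omega) (hP.2 g) (hQ.compT hT g)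
        have h2 := ih (a+1) b (by omega) hP (hQ.2 g)
        convert h1.add h2 using 2
        rename_i x
        beta_reduce
        generalize P (T g x) = a; generalize P x = b; generalize Q (T g x) = c; generalize Q x = d
        revert a b c d; decide

end NDG
namespace NDG
set_option linter.unusedSectionVars false

section chi
variable {Ω : Type*}

/-- the character of a `ZMod 2`-valued function -/
noncomputable def chi (P : Ω → ZMod 2) (x : Ω) : ℝ := if P x = 1 then -1 else 1

lemma chi_add (P Q : Ω → ZMod 2) (x : Ω) : chi (fun x => P x + Q x) x = chi P x * chi Q x := by
  unfold chi
  rcases z2 (P x) with h | h <;> rcases z2 (Q x) with h' | h' <;>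
    simp [h, h', show (1 : ZMod 2) + 1 = 0 from rfl]

lemma chi_meas {m : MeasurableSpace Ω} {P : Ω → ZMod 2} (h : MZ m P) : Measurable[m] (chi P) :=
  Measurable.ite h measurable_const measurable_const

lemma chi_abs (P : Ω → ZMod 2) (x : Ω) : ‖chi P x‖ ≤ 1 := by
  unfold chi; split_ifs <;> simp

lemma chi_sq (P : Ω → ZMod 2) (x : Ω) : chi P x * chi P x = 1 := by
  unfold chi; split_ifs <;> simp

lemma chi_int [m0 : MeasurableSpace Ω] {μ : Measure Ω} [IsProbabilityMeasure μ] {P : Ω → ZMod 2} (h : MZ m0 P) :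
    Integrable (chi P) μ :=
  Integrable.of_bound (chi_meas h).aestronglyMeasurable 1 (Filter.Eventually.of_forall (chi_abs P))

lemma chi_mul_int [m0 : MeasurableSpace Ω] {μ : Measure Ω} {P : Ω → ZMod 2} (h : MZ m0 P)
    {g : Ω → ℝ} (hg : Integrable g μ) : Integrable (fun x => g x * chi P x) μ :=
  hg.mul_bdd (c := 1) (chi_meas h).aestronglyMeasurable (Filter.Eventually.of_forall (chi_abs P))

lemma orth_pi [m0 : MeasurableSpace Ω] {μ : Measure Ω} {M : Set (Ω → ZMod 2)}
    (hM : ∀ Q ∈ M, MZ m0 Q) (hadd : ∀ P ∈ M, ∀ Q ∈ M, (fun x => P x + Q x) ∈ M)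
    (A : Set Ω) (hA : A ∈ generatePiSystem {A | ∃ Q ∈ M, A = {x | Q x = 1}}) :
    MeasurableSet A ∧ ∀ g : Ω → ℝ, Integrable g μ → (∀ Q ∈ M, ∫ x, g x * chi Q x ∂μ = 0) →
      (∀ Q ∈ M, ∫ x, (A.indicator g x) * chi Q x ∂μ = 0) := by
  induction hA with
  | base h =>
    obtain ⟨P, hP, rfl⟩ := h
    refine ⟨hM P hP, fun g hg h Q hQ => ?_⟩
    have e : ∀ x, ({x | P x = 1}.indicator g x) * chi Q x =
        (1/2) * (g x * chi Q x - g x * chi (fun x => P x + Q x) x) := by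
      intro x
      rw [chi_add]
      by_cases hx : P x = 1
      · have : x ∈ {x | P x = 1} := hx
        rw [Set.indicator_of_mem this]; simp [chi, hx]; split_ifs <;> ring
      · have : x ∉ {x | P x = 1} := hx
        rw [Set.indicator_of_notMem this]; simp [chi, hx]
    simp_rw [e]
    rw [integral_const_mul, integral_sub (chi_mul_int (hM Q hQ) hg)
      (chi_mul_int (hM _ (hadd P hP Q hQ)) hg), h Q hQ, h _ (hadd P hP Q hQ)]
    simp
  | inter hs ht _ ihs iht =>
    refine ⟨ihs.1.inter iht.1, fun g hg h Q hQ => ?_⟩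
    rw [Set.inter_comm]
    have := iht.2 _ (hg.indicator ihs.1) (ihs.2 g hg h) Q hQ
    simpa [Set.indicator_indicator] using this

lemma orth_sig [m0 : MeasurableSpace Ω] {μ : Measure Ω} {M : Set (Ω → ZMod 2)}
    (hM : ∀ Q ∈ M, MZ m0 Q) (hadd : ∀ P ∈ M, ∀ Q ∈ M, (fun x => P x + Q x) ∈ M)
    (hz : (fun _ => 0) ∈ M) {g : Ω → ℝ} (hg : Integrable g μ)
    (h : ∀ Q ∈ M, ∫ x, g x * chi Q x ∂μ = 0) {A : Set Ω} (hA : MeasurableSet[sig M] A) :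
    ∫ x in A, g x ∂μ = 0 := by
  have hle : sig M ≤ m0 := sig_le hM
  have h0 : ∫ x, g x ∂μ = 0 := by simpa [chi] using h _ hz
  refine MeasurableSpace.induction_on_inter (m := sig M) (C := fun A _ => ∫ x in A, g x ∂μ = 0)
    (generateFrom_generatePiSystem_eq (g := {A | ∃ Q ∈ M, A = {x | Q x = 1}})).symm
    (isPiSystem_generatePiSystem _) ?_ ?_ ?_ ?_ A hA
  · simp
  · intro t ht
    obtain ⟨h1, h2⟩ := orth_pi (μ := μ) hM hadd t ht
    have := h2 g hg h _ hz
    simpa [chi, integral_indicator h1] using this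
  · intro t ht h1
    have := integral_add_compl (hle _ ht) hg
    rw [h1, h0] at this; linarith
  · intro f hd hf h1
    rw [integral_iUnion (fun i => hle _ (hf i)) hd hg.integrableOn]
    simp [h1]

lemma set_chi [m0 : MeasurableSpace Ω] {μ : Measure Ω} [IsProbabilityMeasure μ] {q : Ω → ZMod 2} (hq : MZ m0 q)
    {A : Set Ω} :
    ∫ x in A, chi q x ∂μ = μ.real (A ∩ {x | q x = 0}) - μ.real (A ∩ {x | q x = 1}) := by
  have e : ∀ x, chi q x = {x | q x = 0}.indicator (fun _ => (1:ℝ)) x - {x | q x = 1}.indicator (fun _ => (1:ℝ)) x := by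
    intro x
    rcases z2 (q x) with h | h <;> simp [chi, h, Set.indicator]
  simp_rw [e]
  rw [integral_sub, integral_indicator hq.zero_set, integral_indicator hq]
  · simp [Measure.restrict_restrict hq.zero_set, Measure.restrict_restrict (show MeasurableSet {x | q x = 1} from hq), Set.inter_comm]
  · exact (integrable_const _).indicator hq.zero_set
  · exact (integrable_const _).indicator hq

lemma half0 [m0 : MeasurableSpace Ω] {μ : Measure Ω} [IsProbabilityMeasure μ] {M : Set (Ω → ZMod 2)}
    (hM : ∀ Q ∈ M, MZ m0 Q) (hadd : ∀ P ∈ M, ∀ Q ∈ M, (fun x => P x + Q x) ∈ M)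
    (hz : (fun _ => 0) ∈ M) {q : Ω → ZMod 2} (hq : MZ m0 q)
    (h : ∀ Q ∈ M, ∫ x, chi (fun x => q x + Q x) x ∂μ = 0) {A : Set Ω} (hA : MeasurableSet[sig M] A) :
    μ.real (A ∩ {x | q x = 0}) = μ.real A / 2 ∧ μ.real (A ∩ {x | q x = 1}) = μ.real A / 2 := by
  have h1 := orth_sig hM hadd hz (chi_int (μ := μ) hq) (by simpa only [chi_add] using h) hA
  rw [set_chi hq] at h1
  have h2 := measureReal_inter_add_sdiff (μ := μ) (s := A) (show MeasurableSet {x | q x = 1} from hq)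
  have h3 : A \ {x | q x = 1} = A ∩ {x | q x = 0} := by
    ext x; rcases z2 (q x) with h | h <;> simp [h]
  rw [h3] at h2
  constructor <;> linarith

end chi

variable {Ω G : Type*} [m0 : MeasurableSpace Ω] {μ : Measure Ω} [IsProbabilityMeasure μ] {T : G → Ω → Ω}

/-- ergodicity -/
def Erg (μ : Measure Ω) (T : G → Ω → Ω) : Prop :=
  ∀ A, MeasurableSet A → (∀ h, T h ⁻¹' A =ᵐ[μ] A) → μ A = 0 ∨ μ Aᶜ = 0

/-- the sigma-algebra of polynomials -/
@[reducible] def sP (μ : Measure Ω) (T : G → Ω → Ω) (e : ℕ) : MeasurableSpace Ω := sig {P | Pol μ T e P}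

lemma sP_le (e : ℕ) : sP μ T e ≤ m0 := sig_le fun _ h => Pol.mz h

lemma null_sP (hT : ∀ h, MeasurePreserving (T h) μ μ) (e : ℕ) {A : Set Ω} (hA : MeasurableSet A) (h : μ A = 0) :
    MeasurableSet[sP μ T e] A := by
  have : Pol μ T e (ind A) := by
    refine Pol.mono hT (Nat.zero_le e) ⟨mz_ind hA, ?_⟩
    have : ∀ᵐ x ∂μ, x ∉ A := measure_eq_zero_iff_ae_notMem.mp h
    filter_upwards [this] with x hx
    simp [ind, hx]
  have := mz_sig (M := {P | Pol μ T e P}) this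
  unfold MZ at this
  rwa [ind_eq_one] at this

/-- sets a.e. equal to measurable sets are measurable -/
lemma aeq_meas {m : MeasurableSpace Ω} (hm : m ≤ m0) (hn : ∀ A, MeasurableSet[m0] A → μ A = 0 → MeasurableSet[m] A)
    {A B : Set Ω} (hA : MeasurableSet[m0] A) (hB : MeasurableSet[m] B) (h : A =ᵐ[μ] B) : MeasurableSet[m] A := by
  have h1 : μ (A \ B) = 0 := (ae_eq_set.mp h).1
  have h2 : μ (B \ A) = 0 := (ae_eq_set.mp h).2
  have : A = (B \ (B \ A)) ∪ (A \ B) := by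
    ext x; by_cases hA : x ∈ A <;> by_cases hB : x ∈ B <;> simp [hA, hB]
  rw [this]
  exact (hB.diff (hn _ ((hm _ hB).diff hA) h2)).union (hn _ (hA.diff (hm _ hB)) h1)

lemma compT_sP (hT : ∀ h, MeasurePreserving (T h) μ μ) (e : ℕ) (g : G) {A : Set Ω}
    (hA : MeasurableSet[sP μ T e] A) : MeasurableSet[sP μ T e] (T g ⁻¹' A) := by
  refine @measurable_generateFrom _ _ (sP μ T e) _ (T g) ?_ _ hA
  rintro _ ⟨Q, hQ, rfl⟩
  exact mz_sig (M := {P | Pol μ T e P}) (Pol.compT hT hQ g)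

end NDG
namespace NDG
variable {Ω G : Type*} [m0 : MeasurableSpace Ω] {μ : Measure Ω} [IsProbabilityMeasure μ] {T : G → Ω → Ω}

lemma dich (hT : ∀ h, MeasurePreserving (T h) μ μ) (hinv : ∀ h x, T h (T h x) = x) (erg : Erg μ T)
    (e : ℕ) {P : Ω → ZMod 2} (hP : Pol μ T (e+1) P) : MZ (sP μ T e) P ∨ ∫ x, chi P x ∂μ = 0 := by
  have hle : sP μ T e ≤ m0 := sP_le e
  set g := μ[chi P | sP μ T e] with hg
  have hgm : Measurable[sP μ T e] g := stronglyMeasurable_condExp.measurable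
  have hgm0 : Measurable[m0] g := hgm.mono hle le_rfl
  have hPi := chi_int (μ := μ) hP.mz
  -- covariance
  have key : ∀ h, ∀ᵐ x ∂μ, chi P (T h x) * g (T h x) = chi P x * g x := by
    intro h
    set D : Ω → ZMod 2 := fun x => P (T h x) + P x with hD
    have hDe : Pol μ T e D := hP.2 h
    have hDm : MZ (sP μ T e) D := mz_sig (M := {P | Pol μ T e P}) hDe
    have e1 : ∀ x, chi P (T h x) = chi D x * chi P x := by
      intro x
      rw [← chi_add]
      simp only [chi, hD]
      rw [add_assoc, CharTwo.add_self_eq_zero, add_zero]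
    have hemb : MeasurableEmbedding (T h) :=
      (MeasurableEquiv.mk ⟨T h, T h, hinv h, hinv h⟩ (hT h).measurable (hT h).measurable).measurableEmbedding
    have e2 : (fun x => g (T h x)) =ᵐ[μ] μ[fun x => chi P (T h x) | sP μ T e] := by
      refine ae_eq_condExp_of_forall_setIntegral_eq hle ?_ ?_ ?_ ?_
      · exact (hT h).integrable_comp_of_integrable hPi
      · intro s _ _
        exact ((hT h).integrable_comp_of_integrable integrable_condExp).integrableOn
      · intro s hs _
        have hs' : MeasurableSet[sP μ T e] (T h ⁻¹' s) := compT_sP hT e h hs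
        have es : s = T h ⁻¹' (T h ⁻¹' s) := by
          ext x; simp [hinv]
        rw [es, (hT h).setIntegral_preimage_emb hemb, (hT h).setIntegral_preimage_emb hemb]
        exact setIntegral_condExp hle hPi hs'
      · have : Measurable[sP μ T e, sP μ T e] (T h) := fun s hs => compT_sP hT e h hs
        exact (hgm.comp this).stronglyMeasurable.aestronglyMeasurable
    have e3 : μ[fun x => chi P (T h x) | sP μ T e] =ᵐ[μ] chi D * g := by
      have : (fun x => chi P (T h x)) = chi D * chi P := by ext x; exact e1 x
      rw [this]
      exact condExp_stronglyMeasurable_mul_of_bound hle (chi_meas hDm).stronglyMeasurable hPi 1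
        (Filter.Eventually.of_forall (chi_abs D))
    filter_upwards [e2, e3] with x h2 h3
    rw [h2, h3, e1]
    have := chi_sq D x
    simp only [Pi.mul_apply]
    linear_combination (chi P x * g x) * this
  have hfm : Measurable[m0] (fun x => chi P x * g x) := (chi_meas hP.mz).mul hgm0
  have inv : ∀ B : Set ℝ, ∀ h, T h ⁻¹' ((fun x => chi P x * g x) ⁻¹' B) =ᵐ[μ] (fun x => chi P x * g x) ⁻¹' B := by
    intro B h
    rw [Filter.eventuallyEq_set]
    filter_upwards [key h] with x hx
    simp [hx]
  have hnull : ∀ A, MeasurableSet[m0] A → μ A = 0 → MeasurableSet[sP μ T e] A := fun A h1 h2 => null_sP hT e h1 h2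
  rcases erg _ (hfm measurableSet_Ioi) (inv (Set.Ioi 0)) with h1 | h1
  · rcases erg _ (hfm measurableSet_Iio) (inv (Set.Iio 0)) with h2 | h2
    · right
      rw [measure_eq_zero_iff_ae_notMem] at h1 h2
      have : g =ᵐ[μ] 0 := by
        filter_upwards [h1, h2] with x h1 h2
        simp only [Set.mem_preimage, Set.mem_Ioi, Set.mem_Iio, not_lt] at h1 h2
        have h3 := chi_sq P x
        have h4 : chi P x * g x = 0 := le_antisymm h1 h2
        have : g x = chi P x * (chi P x * g x) := by rw [← mul_assoc, h3, one_mul]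
        rw [this, h4]; simp
      rw [← integral_condExp hle, ← hg, integral_congr_ae this]; simp
    · left
      refine aeq_meas hle hnull hP.mz (hgm measurableSet_Ioi : MeasurableSet[sP μ T e] (g ⁻¹' (Set.Ioi 0))) ?_
      rw [Filter.eventuallyEq_set]
      rw [measure_eq_zero_iff_ae_notMem] at h2
      filter_upwards [h2] with x h2
      simp only [Set.mem_compl_iff, Set.mem_preimage, Set.mem_Iio, not_not] at h2
      simp only [Set.mem_preimage, Set.mem_Ioi]
      unfold chi at h2
      split_ifs at h2 with h3
      · simp only [h3, true_iff]; linarith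
      · simp only [h3, false_iff]; linarith
  · left
    refine aeq_meas hle hnull hP.mz (hgm measurableSet_Iio : MeasurableSet[sP μ T e] (g ⁻¹' (Set.Iio 0))) ?_
    rw [Filter.eventuallyEq_set]
    rw [measure_eq_zero_iff_ae_notMem] at h1
    filter_upwards [h1] with x h2
    simp only [Set.mem_compl_iff, Set.mem_preimage, Set.mem_Ioi, not_not] at h2
    simp only [Set.mem_preimage, Set.mem_Iio]
    unfold chi at h2
    split_ifs at h2 with h3
    · simp only [h3, true_iff]; linarith
    · simp only [h3, false_iff]; linarith

/-- minimum distance -/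
lemma min_dist (hT : ∀ h, MeasurePreserving (T h) μ μ) (erg : Erg μ T) (d : ℕ) : ∀ {b : Ω → ZMod 2},
    Pol μ T d b → μ.real {x | b x = 1} * 2 ^ d < 1 → ∀ᵐ x ∂μ, b x = 0 := by
  induction d with
  | zero => intro b hb _; exact hb.2
  | succ d ih =>
    intro b hb hlt
    have hbm : MeasurableSet {x | b x = 1} := hb.mz
    have h1 : ∀ h, ∀ᵐ x ∂μ, b (T h x) + b x = 0 := by
      intro h
      refine ih (hb.2 h) ?_
      have : {x | b (T h x) + b x = 1} ⊆ T h ⁻¹' {x | b x = 1} ∪ {x | b x = 1} := by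
        intro x
        simp only [Set.mem_ofPred_eq, Set.mem_union, Set.mem_preimage]
        generalize b (T h x) = u; generalize b x = v; revert u v; decide
      have h2 := (measureReal_mono (μ := μ) this).trans (measureReal_union_le _ _)
      rw [(hT h).measureReal_preimage hbm.nullMeasurableSet] at h2
      calc _ ≤ (μ.real {x | b x = 1} + μ.real {x | b x = 1}) * 2 ^ d := by gcongr
        _ = μ.real {x | b x = 1} * 2 ^ (d+1) := by ring
        _ < 1 := hlt
    rcases erg _ hbm (fun h => by
      rw [Filter.eventuallyEq_set]
      filter_upwards [h1 h] with x hx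
      simp only [Set.mem_ofPred_eq, Set.mem_preimage]
      revert hx
      generalize b (T h x) = u; generalize b x = v; revert u v; decide) with h3 | h3
    · rw [measure_eq_zero_iff_ae_notMem] at h3
      filter_upwards [h3] with x hx
      rcases z2 (b x) with h | h
      · exact h
      · exact absurd h hx
    · exfalso
      have : μ.real {x | b x = 1} = 1 := by
        rw [measureReal_def, (prob_compl_eq_zero_iff hbm).1 h3]; simp
      rw [this, one_mul] at hlt
      exact absurd hlt (not_lt.2 (one_le_pow₀ (by norm_num)))

end NDG
namespace NDG
set_option linter.unusedSectionVars false
variable {Ω G : Type*} [m0 : MeasurableSpace Ω] {μ : Measure Ω} [IsProbabilityMeasure μ] {T : G → Ω → Ω}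

/-- a family of polynomials omitting `q` -/
structure Good (μ : Measure Ω) (T : G → Ω → Ω) (e : ℕ) (M : Set (Ω → ZMod 2)) (q : Ω → ZMod 2) : Prop where
  sub : ∀ Q ∈ M, Pol μ T (e+1) Q
  add : ∀ P ∈ M, ∀ Q ∈ M, (fun x => P x + Q x) ∈ M
  low : ∀ Q, Pol μ T e Q → Q ∈ M
  meas : ∀ Q, Pol μ T (e+1) Q → MZ (sP μ T e) Q → Q ∈ M
  hq : Pol μ T (e+1) q
  hqM : q ∉ M

variable {e : ℕ} {M : Set (Ω → ZMod 2)} {q : Ω → ZMod 2}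

lemma Good.orth (hG : Good μ T e M q) (hT : ∀ h, MeasurePreserving (T h) μ μ) (hinv : ∀ h x, T h (T h x) = x)
    (erg : Erg μ T) : ∀ Q ∈ M, ∫ x, chi (fun x => q x + Q x) x ∂μ = 0 := by
  intro Q hQ
  have h1 : Pol μ T (e+1) (fun x => q x + Q x) := hG.hq.add (hG.sub Q hQ)
  rcases dich hT hinv erg e h1 with h | h
  · exfalso
    apply hG.hqM
    have := hG.add _ (hG.meas _ h1 h) _ hQ
    convert this using 2
    rw [add_assoc, CharTwo.add_self_eq_zero, add_zero]
  · exact h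

lemma Good.zero (hG : Good μ T e M q) : (fun _ => 0) ∈ M := hG.low _ Pol.zero

lemma Good.mz (hG : Good μ T e M q) : ∀ Q ∈ M, MZ m0 Q := fun Q hQ => (hG.sub Q hQ).mz

lemma Good.le (hG : Good μ T e M q) : sig M ≤ m0 := sig_le hG.mz

lemma Good.half (hG : Good μ T e M q) (hT : ∀ h, MeasurePreserving (T h) μ μ) (hinv : ∀ h x, T h (T h x) = x)
    (erg : Erg μ T) {A : Set Ω} (hA : MeasurableSet[sig M] A) :
    μ.real (A ∩ {x | q x = 0}) = μ.real A / 2 ∧ μ.real (A ∩ {x | q x = 1}) = μ.real A / 2 :=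
  half0 hG.mz hG.add hG.zero hG.hq.mz (hG.orth hT hinv erg) hA

lemma Good.compT (hG : Good μ T e M q) (g : G) {P : Ω → ZMod 2} (hP : MZ (sig M) P) :
    MZ (sig M) (fun x => P (T g x)) := by
  refine @measurable_generateFrom _ _ (sig M) _ (T g) ?_ _ hP
  rintro _ ⟨Q, hQ, rfl⟩
  refine mz_sig (Q := fun x => Q (T g x)) ?_
  have h1 := (hG.sub Q hQ).2 g
  have := hG.add _ (hG.low _ h1) _ hQ
  convert this using 2
  rw [add_assoc, CharTwo.add_self_eq_zero, add_zero]

lemma Good.null (hG : Good μ T e M q) (hT : ∀ h, MeasurePreserving (T h) μ μ) :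
    ∀ A, MeasurableSet[m0] A → μ A = 0 → MeasurableSet[sig M] A := by
  intro A h1 h2
  exact sig_mono (fun Q hQ => hG.low Q hQ) _ (null_sP hT e h1 h2)

lemma decomp {Ω : Type*} {m : MeasurableSpace Ω} {q : Ω → ZMod 2} {M' : Set (Ω → ZMod 2)}
    (h : ∀ Q ∈ M', ∃ a b, MZ m a ∧ MZ m b ∧ ∀ x, Q x = a x + q x * b x)
    {P : Ω → ZMod 2} (hP : MZ (sig M') P) : ∃ a b, MZ m a ∧ MZ m b ∧ ∀ x, P x = a x + q x * b x := by
  have key : ∀ A, MeasurableSet[sig M'] A → ∃ A1 A2, MeasurableSet[m] A1 ∧ MeasurableSet[m] A2 ∧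
      ∀ x, x ∈ A ↔ (q x = 0 ∧ x ∈ A1) ∨ (q x = 1 ∧ x ∈ A2) := by
    intro A hA
    refine MeasurableSpace.generateFrom_induction _ (fun A _ => ∃ A1 A2, MeasurableSet[m] A1 ∧ MeasurableSet[m] A2 ∧
      ∀ x, x ∈ A ↔ (q x = 0 ∧ x ∈ A1) ∨ (q x = 1 ∧ x ∈ A2)) ?_ ?_ ?_ ?_ A hA
    · rintro _ ⟨Q, hQ, rfl⟩ _
      obtain ⟨a, b, ha, hb, hab⟩ := h Q hQ
      refine ⟨{x | a x = 1}, {x | a x + b x = 1}, ha, ha.add hb, fun x => ?_⟩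
      simp only [Set.mem_ofPred_eq, hab]
      rcases z2 (q x) with h | h <;> simp [h]
    · exact ⟨∅, ∅, MeasurableSet.empty, MeasurableSet.empty, by simp⟩
    · rintro A _ ⟨A1, A2, h1, h2, h3⟩
      refine ⟨A1ᶜ, A2ᶜ, h1.compl, h2.compl, fun x => ?_⟩
      rw [Set.mem_compl_iff, h3]
      rcases z2 (q x) with h | h <;> simp [h]
    · intro s _ hs
      choose A1 A2 h1 h2 h3 using hs
      refine ⟨⋃ n, A1 n, ⋃ n, A2 n, MeasurableSet.iUnion h1, MeasurableSet.iUnion h2, fun x => ?_⟩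
      simp only [Set.mem_iUnion, h3]
      rcases z2 (q x) with h | h <;> simp [h]
  obtain ⟨A1, A2, h1, h2, h3⟩ := key _ hP
  refine ⟨ind A1, fun x => ind A1 x + ind A2 x, mz_ind h1, (mz_ind h1).add (mz_ind h2), fun x => ?_⟩
  have := h3 x
  simp only [Set.mem_ofPred_eq] at this
  rcases z2 (q x) with h | h <;> rcases z2 (P x) with h' | h' <;>
    by_cases hx : x ∈ A1 <;> by_cases hy : x ∈ A2 <;>
    simp [h, h', hx, hy, ind] at this ⊢ <;> rfl

lemma Good.dist (hG : Good μ T e M q) (hT : ∀ h, MeasurePreserving (T h) μ μ) (hinv : ∀ h x, T h (T h x) = x)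
    (erg : Erg μ T) {a b : Ω → ZMod 2} (ha : MZ (sig M) a) (hb : MZ (sig M) b) :
    μ.real {x | b x = 1} / 2 ≤ μ.real {x | a x + q x * b x = 1} := by
  have hq1 : MeasurableSet {x | q x = 1} := hG.hq.mz
  have hq0 : MeasurableSet {x | q x = 0} := hG.hq.mz.zero_set
  have m1 : MeasurableSet[sig M] ({x | b x = 1} ∩ {x | a x = 0}) := MeasurableSet.inter hb ha.zero_set
  have m2 : MeasurableSet[sig M] ({x | b x = 1} ∩ {x | a x = 1}) := MeasurableSet.inter hb ha
  have h1 := (hG.half hT hinv erg m1).2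
  have h2 := (hG.half hT hinv erg m2).1
  have h3 := measureReal_inter_add_sdiff (μ := μ) (s := {x | b x = 1}) (hG.le _ ha)
  have h4 : {x | b x = 1} \ {x | a x = 1} = {x | b x = 1} ∩ {x | a x = 0} := by
    ext x; rcases z2 (a x) with h | h <;> simp [h]
  rw [h4] at h3
  have hd : Disjoint ({x | b x = 1} ∩ {x | a x = 0} ∩ {x | q x = 1}) ({x | b x = 1} ∩ {x | a x = 1} ∩ {x | q x = 0}) := by
    rw [Set.disjoint_left]
    rintro x ⟨_, h⟩ ⟨_, h'⟩
    simp only [Set.mem_ofPred_eq] at h h'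
    rw [h] at h'; exact one_ne_zero h'
  have h5 := measureReal_union (μ := μ) hd ((hG.le _ m2).inter hq0)
  have h6 : ({x | b x = 1} ∩ {x | a x = 0} ∩ {x | q x = 1}) ∪ ({x | b x = 1} ∩ {x | a x = 1} ∩ {x | q x = 0})
      ⊆ {x | a x + q x * b x = 1} := by
    rintro x (⟨⟨h, h'⟩, h''⟩ | ⟨⟨h, h'⟩, h''⟩) <;> simp only [Set.mem_ofPred_eq] at h h' h'' ⊢ <;> simp [h, h', h'']
  have h7 := measureReal_mono (μ := μ) h6
  linarith

lemma Good.uniq (hG : Good μ T e M q) (hT : ∀ h, MeasurePreserving (T h) μ μ) (hinv : ∀ h x, T h (T h x) = x)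
    (erg : Erg μ T) {a b : Ω → ZMod 2} (ha : MZ (sig M) a) (hb : MZ (sig M) b)
    (h : ∀ᵐ x ∂μ, a x + q x * b x = 0) : ∀ᵐ x ∂μ, b x = 0 := by
  have h1 := hG.dist hT hinv erg ha hb
  have h2 : μ.real {x | a x + q x * b x = 1} = 0 := by
    rw [measureReal_def, measure_eq_zero_iff_ae_notMem.2]; · simp
    filter_upwards [h] with x hx
    simp [hx]
  have h3 : μ.real {x | b x = 1} = 0 := le_antisymm (by linarith) measureReal_nonneg
  rw [measureReal_eq_zero_iff, measure_eq_zero_iff_ae_notMem] at h3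
  filter_upwards [h3] with x hx
  rcases z2 (b x) with h | h
  · exact h
  · exact absurd h hx

lemma Good.lemA (hG : Good μ T e M q) (hT : ∀ h, MeasurePreserving (T h) μ μ) (hinv : ∀ h x, T h (T h x) = x)
    (erg : Erg μ T) (d : ℕ) : ∀ {P a b : Ω → ZMod 2}, MZ (sig M) a → MZ (sig M) b →
    (∀ x, P x = a x + q x * b x) → Pol μ T d P → Pol μ T d b := by
  induction d with
  | zero =>
    intro P a b ha hb h hP
    refine ⟨hb.mono hG.le, hG.uniq hT hinv erg ha hb ?_⟩
    filter_upwards [hP.2] with x hx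
    rw [← h, hx]
  | succ d ih =>
    intro P a b ha hb h hP
    refine ⟨hb.mono hG.le, fun g => ?_⟩
    refine ih (P := fun x => P (T g x) + P x)
      (a := fun x => (a (T g x) + a x) + (q (T g x) + q x) * b (T g x)) ?_ ?_ ?_ (hP.2 g)
    · exact ((hG.compT g ha).add ha).add ((mz_sig (hG.low _ (hG.hq.2 g))).mul (hG.compT g hb))
    · exact (hG.compT g hb).add hb
    · intro x
      simp only [h]
      generalize a (T g x) = a1; generalize a x = a2; generalize b (T g x) = b1; generalize b x = b2
      generalize q (T g x) = q1; generalize q x = q2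
      revert a1 a2 b1 b2 q1 q2; decide

lemma Good.close (hG : Good μ T e M q) (hT : ∀ h, MeasurePreserving (T h) μ μ) (hinv : ∀ h x, T h (T h x) = x)
    (erg : Erg μ T) (d : ℕ) {P a b c : Ω → ZMod 2} (ha : MZ (sig M) a) (hb : MZ (sig M) b)
    (h : ∀ x, P x = a x + q x * b x) (hP : Pol μ T d P) (hc : MZ (sig M) c)
    (hlt : μ.real {x | P x + c x = 1} * 2 ^ (d+1) < 1) : MZ (sig M) P := by
  have h1 := hG.dist hT hinv erg (ha.add hc) hb
  have h2 : {x | P x + c x = 1} = {x | a x + c x + q x * b x = 1} := by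
    ext x; simp only [Set.mem_ofPred_eq, h]; ring_nf
  rw [h2] at hlt
  have h3 := min_dist hT erg d (hG.lemA hT hinv erg d ha hb h hP) (by
    calc _ = (μ.real {x | b x = 1} / 2) * 2 ^ (d+1) := by ring
      _ ≤ _ := by gcongr
      _ < 1 := hlt)
  refine aeq_meas hG.le (hG.null hT) hP.mz ha ?_
  rw [Filter.eventuallyEq_set]
  filter_upwards [h3] with x hx
  simp [h, hx]

end NDG
namespace NDG
set_option linter.unusedSectionVars false

/-- dyadic reals -/
def Dy (r : ℝ) : Prop := ∃ (a : ℤ) (b : ℕ), r = (a:ℝ) / 2 ^ b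

lemma Dy.half_add {r s : ℝ} (hr : Dy r) (hs : Dy s) : Dy (r / 2 + s / 2) := by
  obtain ⟨a, b, rfl⟩ := hr
  obtain ⟨c, d, rfl⟩ := hs
  refine ⟨a * 2 ^ d + c * 2 ^ b, b + d + 1, ?_⟩
  push_cast
  field_simp
  ring

variable {Ω G : Type*} [m0 : MeasurableSpace Ω] {μ : Measure Ω} [IsProbabilityMeasure μ] {T : G → Ω → Ω}
variable {e : ℕ} {M : Set (Ω → ZMod 2)} {q : Ω → ZMod 2}

lemma MZ.one {Ω : Type*} {m : MeasurableSpace Ω} : MZ m (fun _ : Ω => 1) := by simp [MZ]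

lemma Good.meas_one (hG : Good μ T e M q) (hT : ∀ h, MeasurePreserving (T h) μ μ) (hinv : ∀ h x, T h (T h x) = x)
    (erg : Erg μ T) {P a b : Ω → ZMod 2} (ha : MZ (sig M) a) (hb : MZ (sig M) b)
    (h : ∀ x, P x = a x + q x * b x) :
    μ.real {x | P x = 1} = μ.real {x | a x = 1} / 2 + μ.real {x | a x + b x = 1} / 2 := by
  have hq1 : MeasurableSet {x | q x = 1} := hG.hq.mz
  rw [← (hG.half hT hinv erg ha).1, ← (hG.half hT hinv erg (ha.add hb)).2]
  rw [← measureReal_union]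
  · congr 1
    ext x
    simp only [Set.mem_ofPred_eq, Set.mem_union, Set.mem_inter_iff, h]
    rcases z2 (q x) with h | h <;> simp [h]
  · rw [Set.disjoint_left]
    rintro x ⟨_, h⟩ ⟨_, h'⟩
    simp only [Set.mem_ofPred_eq] at h h'
    rw [h] at h'; exact zero_ne_one h'
  · exact (hG.le _ (ha.add hb)).inter hq1

lemma claimF (hT : ∀ h, MeasurePreserving (T h) μ μ) (hinv : ∀ h x, T h (T h x) = x)
    (erg : Erg μ T) (e : ℕ) (IH : ∀ d P, Pol μ T d P → MZ (sP μ T e) P → Dy (μ.real {x | P x = 1}))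
    (F : Set (Ω → ZMod 2)) (hF : F.Finite) : (∀ Q ∈ F, Pol μ T (e+1) Q) →
    ∀ d P, Pol μ T d P → MZ (sig ({Q | Pol μ T e Q} ∪ F)) P → Dy (μ.real {x | P x = 1}) := by
  induction F, hF using Set.Finite.induction_on with
  | empty => intro _ d P hP h; exact IH d P hP (by simpa using h)
  | @insert q F _ _ ih =>
    intro hF d P hP hPm
    have ih' := ih (fun Q hQ => hF Q (Set.mem_insert_of_mem _ hQ))
    by_cases hq : MZ (sig ({Q | Pol μ T e Q} ∪ F)) q
    · refine ih' d P hP (hPm.mono (sig_le ?_))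
      rintro Q (hQ | hQ)
      · exact mz_sig (Or.inl hQ)
      · rcases hQ with rfl | hQ
        · exact hq
        · exact mz_sig (Or.inr hQ)
    · have hG : Good μ T e {Q | Pol μ T (e+1) Q ∧ MZ (sig ({Q | Pol μ T e Q} ∪ F)) Q} q := by
        refine ⟨fun Q h => h.1, fun P hP Q hQ => ⟨hP.1.add hQ.1, hP.2.add hQ.2⟩,
          fun Q hQ => ⟨hQ.succ hT, mz_sig (Or.inl hQ)⟩, fun Q h h' => ⟨h, h'.mono (sig_mono Set.subset_union_left)⟩,
          hF q (Set.mem_insert _ _), fun h => hq h.2⟩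
      have hle : sig {Q | Pol μ T (e+1) Q ∧ MZ (sig ({Q | Pol μ T e Q} ∪ F)) Q} ≤ sig ({Q | Pol μ T e Q} ∪ F) :=
        sig_le fun Q h => h.2
      obtain ⟨a, b, ha, hb, hab⟩ := decomp (q := q)
        (m := sig {Q | Pol μ T (e+1) Q ∧ MZ (sig ({Q | Pol μ T e Q} ∪ F)) Q}) (M' := {Q | Pol μ T e Q} ∪ insert q F) (by
          rintro Q (hQ | hQ)
          · exact ⟨Q, fun _ => 0, mz_sig ⟨Pol.succ hT hQ, mz_sig (Or.inl hQ)⟩, MZ.zero, by simp⟩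
          · rcases hQ with rfl | hQ
            · exact ⟨fun _ => 0, fun _ => 1, MZ.zero, MZ.one, by simp⟩
            · exact ⟨Q, fun _ => 0, mz_sig ⟨hF Q (Or.inr hQ), mz_sig (Or.inr hQ)⟩, MZ.zero, by simp⟩) hPm
      have hbP : Pol μ T d b := hG.lemA hT hinv erg d ha hb hab hP
      have hqb := Pol.mul hT (e+1+d) (e+1) d rfl hG.hq hbP
      have haP : Pol μ T (e+1+d) a := by
        have := (hP.mono hT (show d ≤ e+1+d by omega)).add hqb
        convert this using 2
        rw [hab, add_assoc, CharTwo.add_self_eq_zero, add_zero]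
      rw [hG.meas_one hT hinv erg ha hb hab]
      exact (ih' _ a haP (ha.mono hle)).half_add
        (ih' _ (fun x => a x + b x) (haP.add (hbP.mono hT (by omega))) ((ha.add hb).mono hle))

lemma approx {M : Set (Ω → ZMod 2)} (hM : ∀ Q ∈ M, MZ m0 Q) {P : Ω → ZMod 2} (hP : MZ (sig M) P)
    {ε : ℝ} (hε : 0 < ε) : ∃ F : Set (Ω → ZMod 2), F.Finite ∧ F ⊆ M ∧ ∃ c, MZ (sig F) c ∧
      μ.real {x | P x + c x = 1} < ε := by
  have hle : sig M ≤ m0 := sig_le hM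
  let C : Set (Set Ω) := {A | ∃ F : Set (Ω → ZMod 2), F.Finite ∧ F ⊆ M ∧ MeasurableSet[sig F] A}
  have hC : IsSetRing C := by
    refine ⟨⟨∅, Set.finite_empty, Set.empty_subset _, @MeasurableSet.empty _ (sig ∅)⟩, ?_, ?_⟩
    · rintro s t ⟨F, hF, hFM, hs⟩ ⟨F', hF', hFM', ht⟩
      exact ⟨F ∪ F', hF.union hF', Set.union_subset hFM hFM',
        (sig_mono Set.subset_union_left _ hs).union (sig_mono Set.subset_union_right _ ht)⟩
    · rintro s t ⟨F, hF, hFM, hs⟩ ⟨F', hF', hFM', ht⟩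
      exact ⟨F ∪ F', hF.union hF', Set.union_subset hFM hFM',
        (sig_mono Set.subset_union_left _ hs).diff (sig_mono Set.subset_union_right _ ht)⟩
  have hgen : sig M = MeasurableSpace.generateFrom C := by
    apply le_antisymm
    · refine sig_le fun Q hQ => MeasurableSpace.measurableSet_generateFrom
        ⟨{Q}, Set.finite_singleton _, by simpa using hQ, mz_sig rfl⟩
    · apply MeasurableSpace.generateFrom_le
      rintro A ⟨F, _, hFM, hA⟩
      exact sig_mono hFM _ hA
  have hcov : ∃ D : Set (Set Ω), D.Countable ∧ D ⊆ C ∧ (μ.trim hle) (⋃₀ D)ᶜ = 0 := by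
    refine ⟨{Set.univ}, Set.countable_singleton _, ?_, by simp⟩
    rintro _ rfl
    exact ⟨∅, Set.finite_empty, Set.empty_subset _, @MeasurableSet.univ _ (sig ∅)⟩
  have : IsProbabilityMeasure (μ.trim hle) := ⟨by rw [trim_measurableSet_eq hle MeasurableSet.univ]; simp⟩
  obtain ⟨t, ⟨F, hF, hFM, ht⟩, hlt⟩ := @exists_measure_symmDiff_lt_of_generateFrom_isSetRing Ω (sig M) (μ.trim hle) _ C
    hC hcov hgen _ hP (ENNReal.ofReal ε) (by simpa using hε)
  refine ⟨F, hF, hFM, ind t, mz_ind ht, ?_⟩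
  rw [trim_measurableSet_eq hle (MeasurableSet.symmDiff (sig_mono hFM _ ht) hP)] at hlt
  have e1 : {x | P x + ind t x = 1} = symmDiff t {x | P x = 1} := by
    ext x
    rw [Set.mem_symmDiff]
    by_cases hx : x ∈ t <;> rcases z2 (P x) with h | h <;> simp [hx, h, ind]
  rw [e1, measureReal_def]
  exact (ENNReal.lt_ofReal_iff_toReal_lt (measure_ne_top _ _)).1 hlt

lemma Good.int_zero (hG : Good μ T e M q) (hT : ∀ h, MeasurePreserving (T h) μ μ) (hinv : ∀ h x, T h (T h x) = x)
    (erg : Erg μ T) {E : Ω → ℝ} (hE : Integrable E μ) (hEm : Measurable[sig M] E) :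
    ∫ x, E x * chi q x ∂μ = 0 := by
  have hq := chi_int (μ := μ) hG.hq.mz
  have h0 : (fun _ => (0:ℝ)) =ᵐ[μ] μ[chi q | sig M] := by
    refine ae_eq_condExp_of_forall_setIntegral_eq hG.le hq ?_ ?_ ?_
    · intro s _ _; exact (integrable_zero _ _ _).integrableOn
    · intro s hs _
      have := orth_sig hG.mz hG.add hG.zero hq (by simpa only [chi_add] using hG.orth hT hinv erg) hs
      rw [this]; simp
    · exact stronglyMeasurable_const.aestronglyMeasurable
  have hi : Integrable (E * chi q) μ := chi_mul_int hG.hq.mz hE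
  have h1 := condExp_mul_of_stronglyMeasurable_left (m := sig M) hEm.stronglyMeasurable hi hq
  have h2 : ∫ x, (E * chi q) x ∂μ = 0 := by
    rw [← integral_condExp hG.le, integral_congr_ae h1]
    apply integral_eq_zero_of_ae
    filter_upwards [h0] with x hx
    simp [← hx]
  exact h2

lemma finite_type (hT : ∀ h, MeasurePreserving (T h) μ μ) (hinv : ∀ h x, T h (T h x) = x)
    (erg : Erg μ T) (e d : ℕ) {P : Ω → ZMod 2} (hP : Pol μ T d P) (hPm : MZ (sP μ T (e+1)) P) :
    ∃ F : Set (Ω → ZMod 2), F.Finite ∧ (∀ Q ∈ F, Pol μ T (e+1) Q) ∧ MZ (sig ({Q | Pol μ T e Q} ∪ F)) P := by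
  obtain ⟨F, hF, hFM, c, hc, hlt⟩ := approx (μ := μ) (M := {Q | Pol μ T (e+1) Q}) (fun Q hQ => Pol.mz hQ) hPm
    (ε := 1 / 2 ^ (d+1)) (by positivity)
  rw [lt_div_iff₀ (by positivity)] at hlt
  refine ⟨F, hF, hFM, ?_⟩
  have hle : sig ({Q | Pol μ T e Q} ∪ F) ≤ m0 := sig_le (by
    rintro Q (hQ | hQ)
    · exact Pol.mz hQ
    · exact Pol.mz (hFM hQ))
  have hle1 : sig ({Q | Pol μ T e Q} ∪ F) ≤ sP μ T (e+1) := sig_mono (by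
    rintro Q (hQ | hQ)
    · exact Pol.succ hT hQ
    · exact hFM hQ)
  let N : Submodule (ZMod 2) (Ω → ZMod 2) :=
    { carrier := {Q | Pol μ T (e+1) Q ∧ MZ (sig ({Q | Pol μ T e Q} ∪ F)) Q}
      add_mem' := fun {P Q} hP hQ => ⟨hP.1.add hQ.1, hP.2.add hQ.2⟩
      zero_mem' := ⟨Pol.zero, MZ.zero⟩
      smul_mem' := by
        intro c Q hQ
        rcases z2 c with rfl | rfl
        · rw [zero_smul]; exact ⟨Pol.zero, MZ.zero⟩
        · rw [one_smul]; exact hQ }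
  have hPi := chi_int (μ := μ) hP.mz
  set E := μ[chi P | sig ({Q | Pol μ T e Q} ∪ F)] with hE
  have hEm : Measurable[sig ({Q | Pol μ T e Q} ∪ F)] E := stronglyMeasurable_condExp.measurable
  have hEi : Integrable E μ := integrable_condExp
  have main : ∀ Q ∈ {Q | Pol μ T (e+1) Q}, ∫ x, (chi P x - E x) * chi Q x ∂μ = 0 := by
    intro q hq
    have e1 : ∫ x, (chi P x - E x) * chi q x ∂μ = ∫ x, chi P x * chi q x ∂μ - ∫ x, E x * chi q x ∂μ := by
      rw [← integral_sub (chi_mul_int hq.mz hPi) (chi_mul_int hq.mz hEi)]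
      simp only [sub_mul]
    rw [e1]
    by_cases hqN : q ∈ N
    · have h1 := condExp_mul_of_stronglyMeasurable_right (m := sig ({Q | Pol μ T e Q} ∪ F))
        (chi_meas hqN.2).stronglyMeasurable (f := chi P) (chi_mul_int hq.mz hPi) hPi
      have h2 : ∫ x, (chi P * chi q) x ∂μ = ∫ x, E x * chi q x ∂μ := by
        rw [← integral_condExp hle, integral_congr_ae h1]; rfl
      rw [← h2]; simp
    · obtain ⟨η, hη, hN⟩ := Submodule.exists_le_ker_of_notMem hqN
      have hηN : ∀ Q ∈ N, η Q = 0 := fun Q hQ => hN hQ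
      have hη1 : η q = 1 := (z2 _).resolve_left hη
      have hG : Good μ T e {Q | Pol μ T (e+1) Q ∧ η Q = 0} q := by
        refine ⟨fun Q h => h.1, ?_, ?_, ?_, hq, fun h => hη h.2⟩
        · rintro P ⟨hP, hP'⟩ Q ⟨hQ, hQ'⟩
          refine ⟨hP.add hQ, ?_⟩
          have := η.map_add P Q
          rw [hP', hQ', add_zero] at this
          exact this
        · intro Q hQ
          exact ⟨hQ.succ hT, hηN Q ⟨hQ.succ hT, mz_sig (Or.inl hQ)⟩⟩
        · intro Q hQ hQm
          exact ⟨hQ, hηN Q ⟨hQ, hQm.mono (sig_mono Set.subset_union_left)⟩⟩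
      have hFs : sig ({Q | Pol μ T e Q} ∪ F) ≤ sig {Q | Pol μ T (e+1) Q ∧ η Q = 0} := by
        apply sig_mono
        rintro Q (hQ | hQ)
        · exact hG.low Q hQ
        · exact ⟨hFM hQ, hηN Q ⟨hFM hQ, mz_sig (Or.inr hQ)⟩⟩
      obtain ⟨a, b, ha, hb, hab⟩ := decomp (q := q) (m := sig {Q | Pol μ T (e+1) Q ∧ η Q = 0})
        (M' := {Q | Pol μ T (e+1) Q}) (by
          intro Q hQ
          rcases z2 (η Q) with h | h
          · exact ⟨Q, fun _ => 0, mz_sig ⟨hQ, h⟩, MZ.zero, by simp⟩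
          · refine ⟨fun x => Q x + q x, fun _ => 1, mz_sig ⟨hQ.add hq, ?_⟩, MZ.one, fun x => ?_⟩
            · have := η.map_add Q q
              rw [h, hη1] at this
              exact this
            · simp [add_assoc, CharTwo.add_self_eq_zero]) hPm
      have hPM := hG.close hT hinv erg d ha hb hab hP (hc.mono ((sig_mono Set.subset_union_right).trans hFs)) hlt
      rw [hG.int_zero hT hinv erg hPi (chi_meas hPM), hG.int_zero hT hinv erg hEi (hEm.mono hFs le_rfl), sub_zero]
  have h1 : E =ᵐ[μ] μ[chi P | sP μ T (e+1)] := by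
    refine ae_eq_condExp_of_forall_setIntegral_eq (sP_le _) hPi (fun s _ _ => hEi.integrableOn) ?_ ?_
    · intro s hs _
      have := orth_sig (M := {Q | Pol μ T (e+1) Q}) (fun Q hQ => Pol.mz hQ) (fun P hP Q hQ => Pol.add hP hQ) Pol.zero
        (hPi.sub hEi) main hs
      have h2 : ∫ x in s, (chi P x - E x) ∂μ = 0 := this
      rw [integral_sub hPi.integrableOn hEi.integrableOn] at h2
      linarith
    · exact (hEm.mono hle1 le_rfl).stronglyMeasurable.aestronglyMeasurable
  rw [condExp_of_stronglyMeasurable (sP_le _) (chi_meas hPm).stronglyMeasurable hPi] at h1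
  refine aeq_meas hle (fun A hA h => sig_mono Set.subset_union_left _ (null_sP hT e hA h)) hP.mz
    (hEm measurableSet_Iio : MeasurableSet[sig ({Q | Pol μ T e Q} ∪ F)] (E ⁻¹' (Set.Iio 0))) ?_
  rw [Filter.eventuallyEq_set]
  filter_upwards [h1] with x hx
  simp only [Set.mem_preimage, hx, Set.mem_Iio, chi, Set.mem_ofPred_eq]
  split_ifs with h <;> simp [h]

lemma claim (hT : ∀ h, MeasurePreserving (T h) μ μ) (hinv : ∀ h x, T h (T h x) = x)
    (erg : Erg μ T) (e : ℕ) : ∀ d P, Pol μ T d P → MZ (sP μ T e) P → Dy (μ.real {x | P x = 1}) := by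
  induction e with
  | zero =>
    intro d P _ hP
    have : ∀ A, MeasurableSet[sP μ T 0] A → μ A = 0 ∨ μ Aᶜ = 0 := by
      intro A hA
      refine MeasurableSpace.generateFrom_induction _ (fun A _ => μ A = 0 ∨ μ Aᶜ = 0) ?_ ?_ ?_ ?_ A hA
      · rintro _ ⟨Q, hQ, rfl⟩ _
        left
        rw [measure_eq_zero_iff_ae_notMem]
        filter_upwards [hQ.2] with x hx
        simp [hx]
      · simp
      · intro t _ h
        rw [compl_compl]; exact h.symm
      · intro s _ h
        by_cases hs : ∀ n, μ (s n) = 0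
        · left; exact measure_iUnion_null hs
        · push Not at hs
          obtain ⟨n, hn⟩ := hs
          right
          exact measure_mono_null (Set.compl_subset_compl.2 (Set.subset_iUnion s n)) ((h n).resolve_left hn)
    rcases this _ hP with h | h
    · exact ⟨0, 0, by simp [measureReal_def, h]⟩
    · refine ⟨1, 0, ?_⟩
      rw [measureReal_def, (prob_compl_eq_zero_iff (sP_le 0 _ hP)).1 h]; simp
  | succ e ih =>
    intro d P hP hPm
    obtain ⟨F, hF, hFM, hPF⟩ := finite_type hT hinv erg e d hP hPm
    exact claimF hT hinv erg e ih F hF hFM d P hP hPF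

theorem abstract_thm (hT : ∀ h, MeasurePreserving (T h) μ μ) (hinv : ∀ h x, T h (T h x) = x)
    (erg : Erg μ T) (d : ℕ) {P : Ω → ZMod 2} (hP : Pol μ T d P) : Dy (μ.real {x | P x = 1}) :=
  claim hT hinv erg d d P hP (mz_sig (M := {Q | Pol μ T d Q}) hP)

end NDG
namespace NDG

section finite
variable {V : Type*} [AddCommGroup V]

/-- polynomials on a group -/
def FP : ℕ → (V → ZMod 2) → Prop
  | 0, P => ∀ x, P x = 0
  | (d+1), P => ∀ h, FP d (fun x => P (x + h) + P x)

lemma FP.zero {d : ℕ} : FP d (fun _ : V => 0) := by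
  induction d with
  | zero => intro x; rfl
  | succ d ih => intro h; simpa using ih

lemma FP.succ {d : ℕ} : ∀ {P : V → ZMod 2}, FP d P → FP (d+1) P := by
  induction d with
  | zero =>
    intro P h g x
    have h' : ∀ x, P x = 0 := h
    simp [h']
  | succ d ih =>
    intro P h g
    exact ih (h g)

lemma FP.mono {d e : ℕ} (hde : d ≤ e) {P : V → ZMod 2} (h : FP d P) : FP e P := by
  induction hde with
  | refl => exact h
  | step _ ih => exact ih.succ

lemma FP.add {d : ℕ} : ∀ {P Q : V → ZMod 2}, FP d P → FP d Q → FP d (fun x => P x + Q x) := by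
  induction d with
  | zero =>
    intro P Q h h' x
    have h1 : ∀ x, P x = 0 := h
    have h2 : ∀ x, Q x = 0 := h'
    simp [h1, h2]
  | succ d ih =>
    intro P Q h h' g
    have := ih (h g) (h' g)
    convert this using 2
    ring

lemma FP.shift {d : ℕ} {P : V → ZMod 2} (h : FP d P) (g : V) : FP d (fun x => P (x + g)) := by
  have h1 := h.succ g
  have := h1.add h
  convert this using 2
  rw [add_assoc, CharTwo.add_self_eq_zero, add_zero]

lemma FP.mul : ∀ (n a b : ℕ), a + b = n →
    ∀ {P Q : V → ZMod 2}, FP a P → FP b Q → FP n (fun x => P x * Q x) := by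
  intro n
  induction n with
  | zero =>
    intro a b hab P Q hP hQ
    obtain rfl : a = 0 := by omega
    have h1 : ∀ x, P x = 0 := hP
    intro x; simp [h1]
  | succ n ih =>
    intro a b hab P Q hP hQ
    cases a with
    | zero =>
      have h1 : ∀ x, P x = 0 := hP
      simpa [h1] using FP.zero
    | succ a =>
      cases b with
      | zero =>
        have h1 : ∀ x, Q x = 0 := hQ
        simpa [h1] using FP.zero
      | succ b =>
        intro g
        have h1 := ih a (b+1) (by omega) (hP g) (hQ.shift g)
        have h2 := ih (a+1) b (by omega) hP (hQ g)
        convert h1.add h2 using 2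
        rename_i x
        beta_reduce
        generalize P (x + g) = a; generalize P x = b; generalize Q (x + g) = c; generalize Q x = d
        revert a b c d; decide

lemma FP.const (c : ZMod 2) : FP 1 (fun _ : V => c) := by
  intro h x
  exact CharTwo.add_self_eq_zero c

lemma FP.sum {ι : Type*} (s : Finset ι) {d : ℕ} {P : ι → V → ZMod 2} (h : ∀ i ∈ s, FP d (P i)) :
    FP d (fun x => ∑ i ∈ s, P i x) := by
  classical
  induction s using Finset.induction_on with
  | empty => simpa using FP.zero
  | insert a s ha ih =>
    simp only [Finset.sum_insert ha]
    exact (h a (Finset.mem_insert_self _ _)).add (ih fun i hi => h i (Finset.mem_insert_of_mem hi))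

lemma FP.coord {m : ℕ} (i : Fin m) : FP 2 (fun x : Fin m → ZMod 2 => x i) := by
  intro h g x
  simp only [Pi.add_apply]
  have : ∀ a b c : ZMod 2, a + c + b + (a + c) + (a + b + a) = 0 := by decide
  exact this _ _ _

lemma FP.mset {m : ℕ} (t : Multiset (Fin m)) :
    FP (2 * Multiset.card t + 1) (fun x : Fin m → ZMod 2 => (t.map x).prod) := by
  induction t using Multiset.induction_on with
  | empty => simpa using FP.const 1
  | cons a t ih =>
    simp only [Multiset.map_cons, Multiset.prod_cons, Multiset.card_cons]
    exact FP.mul _ _ _ (by ring) (FP.coord a) ih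

lemma FP.deg {m d : ℕ} {P : (Fin m → ZMod 2) → ZMod 2} (h : DegLE d P) : FP (2 * d + 2) P := by
  obtain ⟨p, hp, hP⟩ := h
  obtain rfl : (fun x => MvPolynomial.eval x p) = P := funext hP
  have e : (fun x => MvPolynomial.eval x p) = fun x : Fin m → ZMod 2 =>
      ∑ s ∈ p.support, p.coeff s * ((Finsupp.toMultiset s).map x).prod := by
    funext x
    rw [MvPolynomial.eval_eq']
    refine Finset.sum_congr rfl fun s _ => ?_
    congr 1
    rw [Finsupp.toMultiset_map, Finsupp.prod_toMultiset, Finsupp.prod_mapDomain_index (by simp) (by simp [pow_add])]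
    rw [Finsupp.prod_fintype]
    simp
  rw [e]
  refine FP.sum _ fun s hs => ?_
  refine FP.mul _ 1 (2 * d + 1) (by ring) (FP.const _) ?_
  refine FP.mono ?_ (FP.mset _)
  rw [MvPolynomial.totalDegree_eq] at hp
  have := (Finset.le_sup (f := fun m => Multiset.card (Finsupp.toMultiset m)) hs).trans hp
  omega

end finite

end NDG
namespace NDG
open Filter Topology
open scoped CompactlySupported

section limit
variable (m : ℕ → ℕ)

/-- disjoint union of the cubes -/
abbrev XX := Σ n, (Fin (m n) → ZMod 2)
/-- its Stone–Cech compactification -/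
abbrev KK := Ultrafilter (XX m)

noncomputable instance : MeasurableSpace (KK m) := borel _
instance : BorelSpace (KK m) := ⟨rfl⟩

variable {m}

/-- average over the `n`-th cube -/
noncomputable def avg (f : XX m → ℝ) (n : ℕ) : ℝ :=
  (∑ x : Fin (m n) → ZMod 2, f ⟨n, x⟩) / (Fintype.card (Fin (m n) → ZMod 2) : ℝ)

lemma card_pos' (n : ℕ) : (0:ℝ) < (Fintype.card (Fin (m n) → ZMod 2) : ℝ) := by
  exact_mod_cast Fintype.card_pos

lemma avg_add (f g : XX m → ℝ) (n : ℕ) : avg (fun x => f x + g x) n = avg f n + avg g n := by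
  simp [avg, Finset.sum_add_distrib, add_div]

lemma avg_smul (c : ℝ) (f : XX m → ℝ) (n : ℕ) : avg (fun x => c * f x) n = c * avg f n := by
  simp [avg, ← Finset.mul_sum, mul_div_assoc]

lemma avg_const (c : ℝ) (n : ℕ) : avg (fun _ : XX m => c) n = c := by
  have := (card_pos' (m := m) n).ne'
  simp only [avg, Finset.sum_const, nsmul_eq_mul, Finset.card_univ]
  field_simp

lemma avg_mono {f g : XX m → ℝ} (n : ℕ) (h : ∀ x, f ⟨n, x⟩ ≤ g ⟨n, x⟩) : avg f n ≤ avg g n := by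
  unfold avg
  have := card_pos' (m := m) n
  gcongr with x
  exact h x

/-- restriction of a function on the compactification -/
def res (φ : KK m → ℝ) : XX m → ℝ := fun x => φ (pure x)

/-- the ultrafilter limit -/
noncomputable def ulim (f : ℕ → ℝ) : ℝ := limUnder (hyperfilter ℕ : Filter ℕ) f

lemma ulim_tendsto {f : ℕ → ℝ} {C : ℝ} (h : ∀ n, |f n| ≤ C) :
    Tendsto f (hyperfilter ℕ : Filter ℕ) (𝓝 (ulim f)) := by
  have hc : IsCompact (Set.Icc (-C) C) := isCompact_Icc
  obtain ⟨x, _, hx⟩ := hc.ultrafilter_le_nhds (Ultrafilter.map f (hyperfilter ℕ)) (by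
    rw [le_principal_iff]
    refine Ultrafilter.mem_map.2 ?_
    have : f ⁻¹' (Set.Icc (-C) C) = Set.univ := by
      ext n
      simpa using abs_le.1 (h n)
    rw [this]; exact Filter.univ_mem)
  exact tendsto_nhds_limUnder ⟨x, hx⟩

lemma avg_res_bound {φ : KK m → ℝ} (hφ : Continuous φ) : ∃ C, (∀ u, |φ u| ≤ C) ∧ ∀ n, |avg (res φ) n| ≤ C := by
  obtain ⟨C, hC⟩ := (isCompact_univ (X := KK m)).exists_bound_of_continuousOn hφ.continuousOn
  have hC' : ∀ u, |φ u| ≤ C := fun u => hC u trivial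
  refine ⟨C, hC', fun n => ?_⟩
  rw [abs_le]
  constructor
  · rw [← avg_const (m := m) (-C) n]
    exact avg_mono n fun x => (abs_le.1 (hC' _)).1
  · rw [← avg_const (m := m) C n]
    exact avg_mono n fun x => (abs_le.1 (hC' _)).2

lemma avg_tendsto {φ : KK m → ℝ} (hφ : Continuous φ) :
    Tendsto (avg (res φ)) (hyperfilter ℕ : Filter ℕ) (𝓝 (ulim (avg (res φ)))) := by
  obtain ⟨C, _, h⟩ := avg_res_bound hφ
  exact ulim_tendsto h

variable (m) in
/-- the limit functional -/
noncomputable def Lam : C_c(KK m, ℝ) →ₚ[ℝ] ℝ :=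
  PositiveLinearMap.mk₀
    { toFun := fun φ => ulim (avg (res φ))
      map_add' := by
        intro φ ψ
        refine tendsto_nhds_unique (avg_tendsto (map_continuous (φ + ψ))) ?_
        convert (avg_tendsto (map_continuous φ)).add (avg_tendsto (map_continuous ψ)) using 2
        exact avg_add _ _ _
      map_smul' := by
        intro c φ
        refine tendsto_nhds_unique (avg_tendsto (map_continuous (c • φ))) ?_
        exact ((avg_tendsto (map_continuous φ)).const_mul c).congr (fun n => (avg_smul _ _ _).symm) }
    (by
      intro φ hφ
      refine ge_of_tendsto (avg_tendsto (map_continuous φ)) (Eventually.of_forall fun n => ?_)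
      rw [← avg_const (m := m) 0 n]
      exact avg_mono n fun x => hφ _)

variable (m) in
/-- the limit measure -/
noncomputable def mu : Measure (KK m) := RealRMK.rieszMeasure (Lam m)

instance : (mu m).Regular := RealRMK.regular_rieszMeasure _

lemma mu_tendsto {φ : KK m → ℝ} (hφ : Continuous φ) :
    Tendsto (avg (res φ)) (hyperfilter ℕ : Filter ℕ) (𝓝 (∫ u, φ u ∂(mu m))) := by
  have h := RealRMK.integral_rieszMeasure (Lam m) ⟨⟨φ, hφ⟩, HasCompactSupport.of_compactSpace φ⟩
  have h2 : ∫ u, φ u ∂(mu m) = ulim (avg (res φ)) := h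
  rw [h2]
  exact avg_tendsto hφ

instance : IsProbabilityMeasure (mu m) := by
  have : IsFiniteMeasure (mu m) := inferInstance
  have h := mu_tendsto (m := m) (φ := fun _ => 1) continuous_const
  have h2 : avg (res (fun _ : KK m => (1:ℝ))) = fun _ => 1 := funext fun n => avg_const 1 n
  rw [h2] at h
  have h3 := tendsto_nhds_unique h tendsto_const_nhds
  simp only [integral_const, smul_eq_mul, mul_one] at h3
  constructor
  rw [measureReal_def] at h3
  exact (ENNReal.toReal_eq_one_iff _).1 h3

/-- translations of the cubes -/
def tau (h : ∀ n, Fin (m n) → ZMod 2) : XX m → XX m := fun x => ⟨x.1, x.2 + h x.1⟩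

/-- translations of the compactification -/
def TT (h : ∀ n, Fin (m n) → ZMod 2) : KK m → KK m := fun u => u.map (tau h)

lemma tau_tau (h : ∀ n, Fin (m n) → ZMod 2) (x : XX m) : tau h (tau h x) = x := by
  obtain ⟨n, x⟩ := x
  have : x + h n + h n = x := by
    funext i
    simp only [Pi.add_apply]
    rw [add_assoc, CharTwo.add_self_eq_zero, add_zero]
  exact congrArg (Sigma.mk n) this

lemma TT_TT (h : ∀ n, Fin (m n) → ZMod 2) (u : KK m) : TT h (TT h u) = u := by
  unfold TT
  rw [Ultrafilter.map_map]
  have : tau h ∘ tau h = id := funext fun x => tau_tau h x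
  rw [this, Ultrafilter.map_id]

lemma TT_pure (h : ∀ n, Fin (m n) → ZMod 2) (x : XX m) : TT h (pure x) = pure (tau h x) := by
  unfold TT; exact Ultrafilter.map_pure _ _

lemma TT_cont (h : ∀ n, Fin (m n) → ZMod 2) : Continuous (TT h) := by
  refine continuous_generateFrom_iff.2 ?_
  rintro _ ⟨s, rfl⟩
  exact ultrafilter_isOpen_basic (tau h ⁻¹' s)

/-- translation as a homeomorphism -/
def TTh (h : ∀ n, Fin (m n) → ZMod 2) : KK m ≃ₜ KK m where
  toFun := TT h
  invFun := TT h
  left_inv := TT_TT h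
  right_inv := TT_TT h
  continuous_toFun := TT_cont h
  continuous_invFun := TT_cont h

lemma avg_shift (h : ∀ n, Fin (m n) → ZMod 2) (f : XX m → ℝ) (n : ℕ) : avg (fun x => f (tau h x)) n = avg f n := by
  unfold avg
  congr 1
  exact Fintype.sum_equiv (Equiv.addRight (h n)) _ _ (fun x => rfl)

lemma TT_mp (h : ∀ n, Fin (m n) → ZMod 2) : MeasurePreserving (TT h) (mu m) (mu m) := by
  refine ⟨(TT_cont h).measurable, ?_⟩
  have : (Measure.map (TT h) (mu m)).Regular := Measure.Regular.map (TTh h)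
  refine Measure.ext_of_integral_eq_on_compactlySupported fun φ => ?_
  rw [integral_map (TT_cont h).measurable.aemeasurable (map_continuous φ).aestronglyMeasurable]
  refine tendsto_nhds_unique (mu_tendsto ((map_continuous φ).comp (TT_cont h))) ?_
  convert mu_tendsto (map_continuous φ) using 1
  funext n
  rw [← avg_shift h]
  congr 1
  funext x
  simp only [res, TT_pure, tau_tau]

/-- extension of a function to the compactification -/
noncomputable def hat (P : XX m → ZMod 2) : KK m → ZMod 2 := ind {u | {x | P x = 1} ∈ u}

lemma hat_one (P : XX m → ZMod 2) (u : KK m) : hat P u = 1 ↔ {x | P x = 1} ∈ u := by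
  unfold hat ind; split_ifs with h <;> simpa using h

lemma hat_TT (P : XX m → ZMod 2) (h : ∀ n, Fin (m n) → ZMod 2) (u : KK m) :
    hat P (TT h u) = hat (fun x => P (tau h x)) u := rfl

lemma hat_add (P Q : XX m → ZMod 2) (u : KK m) : hat (fun x => P x + Q x) u = hat P u + hat Q u := by
  have key : ∀ a b c : ZMod 2, (c = 1 ↔ ¬ (a = 1 ↔ b = 1)) → c = a + b := by decide
  apply key
  rw [hat_one, hat_one, hat_one]
  have h1 : {x | P x + Q x = 1} ∈ u ↔ ¬ {x | P x = 1 ↔ Q x = 1} ∈ u := by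
    rw [← Ultrafilter.compl_mem_iff_notMem]
    have : {x | P x + Q x = 1} = {x | P x = 1 ↔ Q x = 1}ᶜ := by
      ext x
      simp only [Set.mem_ofPred_eq, Set.mem_compl_iff]
      generalize P x = a; generalize Q x = b; revert a b; decide
    rw [this]
  rw [h1, not_iff_not]
  constructor
  · intro h
    constructor
    · intro h'
      filter_upwards [h, h'] with x h1 h2 using h1.1 h2
    · intro h'
      filter_upwards [h, h'] with x h1 h2 using h1.2 h2
  · intro h
    by_cases h' : {x | P x = 1} ∈ u
    · filter_upwards [h', h.1 h'] with x h1 h2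
      exact ⟨fun _ => h2, fun _ => h1⟩
    · have h'' := mt h.2 h'
      rw [← Ultrafilter.compl_mem_iff_notMem] at h' h''
      filter_upwards [h', h''] with x h1 h2
      exact ⟨fun h => absurd h h1, fun h => absurd h h2⟩

lemma hat_mz (P : XX m → ZMod 2) : MZ (inferInstance : MeasurableSpace (KK m)) (hat P) := by
  apply mz_ind
  exact (ultrafilter_isOpen_basic _).measurableSet

lemma hat_pol (d : ℕ) : ∀ (P : XX m → ZMod 2), (∀ n, FP d (fun x => P ⟨n, x⟩)) → Pol (mu m) TT d (hat P) := by
  induction d with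
  | zero =>
    intro P hP
    refine ⟨hat_mz P, Eventually.of_forall fun u => ?_⟩
    refine (z2 _).resolve_right fun h => ?_
    rw [hat_one] at h
    have : {x | P x = 1} = ∅ := by
      ext ⟨n, x⟩
      have : P ⟨n, x⟩ = 0 := hP n x
      simp [this]
    rw [this] at h
    exact Ultrafilter.empty_notMem h
  | succ d ih =>
    intro P hP
    refine ⟨hat_mz P, fun h => ?_⟩
    have := ih (fun x => P (tau h x) + P x) (fun n => hP n (h n))
    convert this using 2
    rw [hat_TT, hat_add]

lemma hat_meas (P : XX m → ZMod 2) {ρ : ℝ}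
    (h : Tendsto (fun n => prOne (fun x => P ⟨n, x⟩)) atTop (𝓝 ρ)) : (mu m).real {u | hat P u = 1} = ρ := by
  have hcl : IsClopen {u : KK m | hat P u = 1} := by
    simp only [hat_one]
    exact ⟨ultrafilter_isClosed_basic _, ultrafilter_isOpen_basic _⟩
  have hc : Continuous ({u : KK m | hat P u = 1}.indicator (fun _ => (1:ℝ))) :=
    (continuous_const).indicator (by simp [hcl.frontier_eq])
  have h1 := mu_tendsto hc
  rw [integral_indicator hcl.isOpen.measurableSet] at h1
  simp only [integral_const, smul_eq_mul, mul_one, measureReal_restrict_apply_univ] at h1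
  refine tendsto_nhds_unique h1 ?_
  have h2 := h.mono_left (Nat.hyperfilter_le_atTop)
  convert h2 using 1
  funext n
  unfold avg prOne distOf
  congr 1
  rw [Finset.card_filter]
  push_cast
  refine Finset.sum_congr rfl fun x _ => ?_
  have : (pure ⟨n, x⟩ : KK m) ∈ {u : KK m | hat P u = 1} ↔ P ⟨n, x⟩ = 1 := by
    rw [Set.mem_ofPred_eq, hat_one]; exact Iff.rfl
  simp only [res, Set.indicator, this]

end limit
end NDG
namespace NDG
open Filter Topology

section erg
variable {m : ℕ → ℕ}

lemma exists_shift {V : Type*} [Fintype V] [AddCommGroup V] (f : V → ℝ) (a : ℝ)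
    (ha : ∑ x, f x = Fintype.card V * a) : ∃ h, ∑ x, |f x - a| ≤ ∑ x, |f (x + h) - f x| := by
  by_contra! hc
  have h1 : ∑ h : V, ∑ x, |f (x + h) - f x| < ∑ h : V, ∑ x, |f x - a| :=
    Finset.sum_lt_sum_of_nonempty Finset.univ_nonempty fun h _ => hc h
  rw [Finset.sum_comm, Finset.sum_const, Finset.card_univ, nsmul_eq_mul, Finset.mul_sum] at h1
  refine absurd h1 (not_lt.2 (Finset.sum_le_sum fun x _ => ?_))
  have h2 : ∑ h, (f (x + h) - f x) = Fintype.card V * (a - f x) := by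
    rw [Finset.sum_sub_distrib, Fintype.sum_equiv (Equiv.addLeft x) (fun h => f (x + h)) f (fun _ => rfl), ha]
    simp [mul_sub]
  have h3 := Finset.abs_sum_le_sum_abs (fun h => f (x + h) - f x) Finset.univ
  rw [h2, abs_mul, abs_of_nonneg (by positivity : (0:ℝ) ≤ Fintype.card V), abs_sub_comm] at h3
  exact h3

lemma exists_shift' (f : XX m → ℝ) : ∃ h : ∀ n, Fin (m n) → ZMod 2, ∀ n,
    avg (fun x => |f x - avg f n|) n ≤ avg (fun x => |f (tau h x) - f x|) n := by
  have : ∀ n, ∃ h, ∑ x : Fin (m n) → ZMod 2, |f ⟨n, x⟩ - avg f n| ≤ ∑ x, |f ⟨n, x + h⟩ - f ⟨n, x⟩| := by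
    intro n
    refine exists_shift (fun x => f ⟨n, x⟩) _ ?_
    unfold avg
    have := (card_pos' (m := m) n).ne'
    field_simp
  choose h hh using this
  refine ⟨h, fun n => ?_⟩
  unfold avg
  have := card_pos' (m := m) n
  exact div_le_div_of_nonneg_right (hh n) this.le

lemma cont_erg {φ : KK m → ℝ} (hφ : Continuous φ) : ∃ h : ∀ n, Fin (m n) → ZMod 2,
    ∫ u, |φ u - ∫ v, φ v ∂(mu m)| ∂(mu m) ≤ ∫ u, |φ (TT h u) - φ u| ∂(mu m) := by
  obtain ⟨h, hh⟩ := exists_shift' (res φ)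
  refine ⟨h, ?_⟩
  set c := ∫ v, φ v ∂(mu m) with hc
  have h1 := mu_tendsto (m := m) (φ := fun u => |φ u - c|) (by fun_prop)
  have h2 := mu_tendsto (m := m) (φ := fun u => |φ (TT h u) - φ u|) (((hφ.comp (TT_cont h)).sub hφ).abs)
  have h3 := mu_tendsto hφ
  rw [← hc] at h3
  have h4 : Tendsto (fun n => |avg (res φ) n - c|) (hyperfilter ℕ : Filter ℕ) (𝓝 0) := by
    simpa using (h3.sub_const c).abs
  have h5 := h2.add h4
  rw [add_zero] at h5
  refine le_of_tendsto_of_tendsto h1 h5 (Eventually.of_forall fun n => ?_)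
  calc avg (res fun u => |φ u - c|) n
      ≤ avg (fun x => |res φ x - avg (res φ) n| + |avg (res φ) n - c|) n :=
        avg_mono n fun x => abs_sub_le _ _ _
    _ = avg (fun x => |res φ x - avg (res φ) n|) n + |avg (res φ) n - c| := by
        rw [avg_add (fun x => |res φ x - avg (res φ) n|) (fun _ => |avg (res φ) n - c|), avg_const]
    _ ≤ avg (res fun u => |φ (TT h u) - φ u|) n + |avg (res φ) n - c| := by
        gcongr
        refine (hh n).trans (le_of_eq ?_)
        congr 1

lemma TT_int (h : ∀ n, Fin (m n) → ZMod 2) (g : KK m → ℝ) :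
    ∫ u, g (TT h u) ∂(mu m) = ∫ u, g u ∂(mu m) := by
  have hemb : MeasurableEmbedding (TT h) :=
    (MeasurableEquiv.mk ⟨TT h, TT h, TT_TT h, TT_TT h⟩ (TT_mp h).measurable (TT_mp h).measurable).measurableEmbedding
  exact (TT_mp h).integral_comp hemb g

lemma TT_integrable (h : ∀ n, Fin (m n) → ZMod 2) {g : KK m → ℝ} (hg : Integrable g (mu m)) :
    Integrable (fun u => g (TT h u)) (mu m) :=
  (TT_mp h).integrable_comp_of_integrable hg

set_option maxHeartbeats 1000000 in
lemma erg_mu : Erg (mu m) TT := by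
  intro A hA hinv
  set f : KK m → ℝ := A.indicator (fun _ => 1) with hf
  have hfi : Integrable f (mu m) := (integrable_const _).indicator hA
  set p := ∫ u, f u ∂(mu m) with hp
  have key : ∀ ε > 0, ∫ u, |f u - p| ∂(mu m) ≤ 4 * ε := by
    intro ε hε
    obtain ⟨φ, _, h1, hφ, hφi⟩ := hfi.exists_hasCompactSupport_integral_sub_le hε
    simp only [Real.norm_eq_abs] at h1
    obtain ⟨h, hh⟩ := cont_erg hφ
    set c := ∫ v, φ v ∂(mu m) with hc
    have hfT : ∀ᵐ u ∂(mu m), f (TT h u) = f u := by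
      filter_upwards [Filter.eventuallyEq_set.1 (hinv h)] with u hu
      rw [Set.mem_preimage] at hu
      by_cases hu' : u ∈ A
      · rw [hf, Set.indicator_of_mem hu', Set.indicator_of_mem (hu.2 hu')]
      · rw [hf, Set.indicator_of_notMem hu', Set.indicator_of_notMem (fun h => hu' (hu.1 h))]
    have hi1 : Integrable (fun u => |f u - φ u|) (mu m) := (hfi.sub hφi).abs
    have hi2 : Integrable (fun u => |f (TT h u) - φ (TT h u)|) (mu m) :=
      TT_integrable h (g := fun u => |f u - φ u|) hi1
    have e2 : ∫ u, |f (TT h u) - φ (TT h u)| ∂(mu m) = ∫ u, |f u - φ u| ∂(mu m) :=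
      TT_int h (fun u => |f u - φ u|)
    have b1 : ∫ u, |φ (TT h u) - φ u| ∂(mu m) ≤ 2 * ε := by
      calc _ ≤ ∫ u, (|f (TT h u) - φ (TT h u)| + |f u - φ u|) ∂(mu m) := by
            refine integral_mono_ae ?_ (hi2.add hi1) ?_
            · exact ((TT_integrable h hφi).sub hφi).abs
            · filter_upwards [hfT] with u hu
              simp only [hu]
              rw [abs_sub_comm (f u) (φ (TT h u))]
              exact abs_sub_le _ _ _
        _ = _ := integral_add hi2 hi1
        _ ≤ 2 * ε := by rw [e2]; linarith
    have b2 : |c - p| ≤ ε := by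
      rw [hc, hp, ← integral_sub hφi hfi]
      refine (abs_integral_le_integral_abs).trans (le_trans (le_of_eq ?_) h1)
      congr 1; funext u; exact abs_sub_comm _ _
    have hi3 : Integrable (fun u => |φ u - c|) (mu m) := (hφi.sub (integrable_const c)).abs
    calc ∫ u, |f u - p| ∂(mu m) ≤ ∫ u, ((|f u - φ u| + |φ u - c|) + |c - p|) ∂(mu m) := by
          refine integral_mono_ae (hfi.sub (integrable_const p)).abs ((hi1.add hi3).add (integrable_const _)) ?_
          refine Eventually.of_forall fun u => ?_
          have h1 := abs_sub_le (f u) (φ u) p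
          have h2 := abs_sub_le (φ u) c p
          simp only
          linarith
      _ = (∫ u, |f u - φ u| ∂(mu m) + ∫ u, |φ u - c| ∂(mu m)) + |c - p| := by
          have hi4 : Integrable (fun u => |f u - φ u| + |φ u - c|) (mu m) := hi1.add hi3
          rw [integral_add hi4 (integrable_const _), integral_add hi1 hi3]; simp
      _ ≤ 4 * ε := by linarith
  have h0 : ∫ u, |f u - p| ∂(mu m) = 0 := by
    refine le_antisymm ?_ (integral_nonneg fun u => abs_nonneg _)
    refine le_of_forall_pos_le_add fun ε hε => ?_
    have := key (ε / 4) (by linarith)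
    linarith
  have hi5 : Integrable (fun u => |f u - p|) (mu m) := (hfi.sub (integrable_const p)).abs
  rw [integral_eq_zero_iff_of_nonneg (fun u => abs_nonneg _) hi5] at h0
  by_cases hp0 : p = 0
  · left
    rw [measure_eq_zero_iff_ae_notMem]
    filter_upwards [h0] with u hu hu'
    simp only [Pi.zero_apply, abs_eq_zero, hp0, sub_zero, hf, Set.indicator_of_mem hu'] at hu
    exact one_ne_zero hu
  · right
    rw [measure_eq_zero_iff_ae_notMem]
    filter_upwards [h0] with u hu hu'
    simp only [Pi.zero_apply, abs_eq_zero, hf, Set.indicator_of_notMem hu'] at hu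
    apply hp0; linarith

end erg
end NDG

/-- for any non-dyadic `ρ ∈ (0,1)` and any degree bound `d`, every
degree-`d` polynomial is at distance `≥ c = c(d,ρ) > 0` from `Ber(ρ)`. -/
theorem non_dyadic_gap :
    ∀ ρ : ℝ, 0 < ρ → ρ < 1 → (¬ ∃ (a : ℤ) (b : ℕ), ρ = (a:ℝ) / 2 ^ b) →
      ∀ d : ℕ, 0 < d → ∃ c > (0:ℝ), ∀ m : ℕ,
        ∀ P : (Fin m → ZMod 2) → ZMod 2, DegLE d P → |prOne P - ρ| ≥ c := by
  intro ρ _ _ hnd d _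
  by_contra! hc
  have : ∀ n : ℕ, ∃ m, ∃ P : (Fin m → ZMod 2) → ZMod 2, DegLE d P ∧ |prOne P - ρ| < 1 / ((n:ℝ) + 1) :=
    fun n => hc _ (by positivity)
  choose m P hP hlt using this
  apply hnd
  have h1 : Filter.Tendsto (fun n => prOne (P n)) Filter.atTop (nhds ρ) := by
    rw [tendsto_iff_dist_tendsto_zero]
    refine squeeze_zero (fun n => dist_nonneg) (fun n => ?_) tendsto_one_div_add_atTop_nhds_zero_nat
    rw [Real.dist_eq]; exact (hlt n).le
  have h2 := NDG.hat_meas (m := m) (fun x => P x.1 x.2) h1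
  have h3 := NDG.hat_pol (m := m) (2 * d + 2) (fun x => P x.1 x.2) (fun n => NDG.FP.deg (hP n))
  have h4 := NDG.abstract_thm NDG.TT_mp NDG.TT_TT NDG.erg_mu _ h3
  rw [h2] at h4
  exact h4
end

section
/- For every growth function f : ℕ → ℕ and all positive integers K and d, there exist ε > 0, K', and a threshold n₀ such that the following holds. For all n ≥ n₀, all m, and every collection F₁,…,Fₙ of factors of functions 𝔽₂^m → 𝔽₂, each function of degree at most d and each factor of size |F_i| ≤ K, there exist an integer w ≥ n^ε, indices π(1) < ⋯ < π(w) in [n], and factors G₁,…,G_w (finite sets of functions 𝔽₂^m → 𝔽₂, each function of degree at most d) such that: (1) for every i, G_i refines F_{π(i)}; (2) for every i, |G_i| ≤ K'; (3) for all i, j, the factor G_i ∪ G_j is f(|G_i ∪ G_j|)-regular; and (4) the sets G₁,…,G_w form a sunflower, i.e., G_i ∩ G_j = G₁ ∩ ⋯ ∩ G_w for all i ≠ j. -/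
open Finset

/-- The (exact) degree of `P`: the least `d` such that `P` has degree at most `d`. -/
noncomputable def fdeg {m : ℕ} (P : (Fin m → ZMod 2) → ZMod 2) : ℕ :=
  sInf {d | DegLE d P}

/-- A growth function: nondecreasing and at least the identity. -/
def GrowthFn (f : ℕ → ℕ) : Prop := Monotone f ∧ ∀ r, r ≤ f r

/-- The set-factor `G` refines the set-factor `F`: every member of `F` is a
function of the tuple of members of `G`. -/
def FinsetRefines {m : ℕ} (G F : Finset ((Fin m → ZMod 2) → ZMod 2)) : Prop :=
  ∀ P ∈ F, ∃ γ : ({Q // Q ∈ G} → ZMod 2) → ZMod 2, ∀ x, P x = γ (fun Q => Q.1 x)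

/-- The set-factor `F` is `r`-regular: the sum of every nonempty subset `T`, of
degree `ℓ = max_{P ∈ T} deg(P)`, has `rank_{ℓ-1}` greater than `r`. -/
def FinsetRegular {m : ℕ} (r : ℕ) (F : Finset ((Fin m → ZMod 2) → ZMod 2)) : Prop :=
  ∀ T ⊆ F, T.Nonempty →
    ¬ RankLE ((T.sup fdeg) - 1) r (fun x => ∑ P ∈ T, P x)

namespace SPR

abbrev Fn (m : ℕ) := (Fin m → ZMod 2) → ZMod 2

lemma degLE_mono {m a b : ℕ} {P : Fn m} (h : DegLE a P) (hab : a ≤ b) : DegLE b P := by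
  obtain ⟨p, hp, hx⟩ := h
  exact ⟨p, hp.trans hab, hx⟩

lemma degLE_zero {m a : ℕ} : DegLE a (fun _ => 0 : Fn m) := ⟨0, by simp, by simp⟩

lemma degLE_const {m : ℕ} {P : Fn m} (h : DegLE 0 P) (x y) : P x = P y := by
  obtain ⟨p, hp, hx⟩ := h
  have h0 : p.totalDegree = 0 := by omega
  rw [MvPolynomial.totalDegree_eq_zero_iff_eq_C] at h0
  rw [← hx, ← hx, h0]; simp

lemma factor {m : ℕ} {β : Type} (Q : β → Fn m) (P : Fn m)
    (h : ∀ x y, (∀ b, Q b x = Q b y) → P x = P y) :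
    ∃ γ : (β → ZMod 2) → ZMod 2, ∀ x, P x = γ (fun b => Q b x) := by
  classical
  refine ⟨fun v => if hv : ∃ x, (fun b => Q b x) = v then P hv.choose else 0, fun x => ?_⟩
  have hv : ∃ y, (fun b => Q b y) = (fun b => Q b x) := ⟨x, rfl⟩
  simp only [dif_pos hv]
  exact h _ _ (fun b => (congrFun hv.choose_spec b).symm)

lemma rankLE_of {m d' k : ℕ} {β : Type} [Fintype β] (hk : Fintype.card β ≤ k)
    (Q : β → Fn m) (hQ : ∀ b, DegLE d' (Q b)) (P : Fn m)
    (h : ∀ x y, (∀ b, Q b x = Q b y) → P x = P y) : RankLE d' k P := by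
  classical
  let e := Fintype.equivFin β
  let Q' : Fin k → Fn m := fun j =>
    if hj : j.1 < Fintype.card β then Q (e.symm ⟨j.1, hj⟩) else fun _ => 0
  obtain ⟨γ, hγ⟩ := factor Q' P (by
    intro x y hxy
    apply h
    intro b
    have := hxy ⟨(e b).1, (e b).2.trans_le hk⟩
    simpa [Q'] using this)
  refine ⟨Q', γ, ?_, hγ⟩
  intro j
  simp only [Q']
  split_ifs
  · exact hQ _
  · exact degLE_zero

lemma RankLE.mono {m a b r s : ℕ} {P : Fn m} (h : RankLE a r P) (hab : a ≤ b) (hrs : r ≤ s) :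
    RankLE b s P := by
  obtain ⟨Q, Γ, hQ, hP⟩ := h
  refine rankLE_of (β := Fin r) (by simpa using hrs) Q (fun j => degLE_mono (hQ j) hab) P ?_
  intro x y hxy
  rw [hP, hP]; congr 1; funext j; exact hxy j

def LReg {m : ℕ} {α : Type} (r : ℕ) (lab : α → ℕ) (A : α → Fn m) : Prop :=
  ∀ T : Finset α, ∀ k ∈ T, (∀ t ∈ T, lab t ≤ lab k) →
    ¬ RankLE (lab k - 1) r (fun x => ∑ t ∈ T, A t x)

lemma FReg.mono {m r s : ℕ} {F G : Finset (Fn m)} (h : FinsetRegular s G) (hrs : r ≤ s)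
    (hF : F ⊆ G) : FinsetRegular r F := fun T hT hn hr =>
  h T (hT.trans hF) hn (RankLE.mono hr le_rfl hrs)

lemma fdeg_le {m a : ℕ} {P : Fn m} (h : DegLE a P) : fdeg P ≤ a := Nat.sInf_le h

lemma LReg.inj {m : ℕ} {α : Type} {r : ℕ} {lab : α → ℕ} {A : α → Fn m}
    (h : LReg r lab A) : Function.Injective A := by
  classical
  intro s t hst
  by_contra hne
  have key : ∀ k ∈ ({s, t} : Finset α), ¬ (∀ u ∈ ({s, t} : Finset α), lab u ≤ lab k) := by
    intro k hk hu
    apply h _ k hk hu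
    refine rankLE_of (β := Empty) (by simp) (fun b => b.elim) (fun b => b.elim) _ ?_
    intro x y _
    rw [Finset.sum_pair hne, Finset.sum_pair hne, hst, CharTwo.add_self_eq_zero,
      CharTwo.add_self_eq_zero]
  rcases le_total (lab s) (lab t) with h1 | h1
  · exact key t (by simp) (by simp [h1])
  · exact key s (by simp) (by simp [h1])

lemma LReg.fin {m : ℕ} {α : Type} [Fintype α] [DecidableEq (Fn m)] {r : ℕ} {lab : α → ℕ}
    {A : α → Fn m}
    (h : LReg r lab A) (hA : ∀ a, DegLE (lab a) (A a)) :
    FinsetRegular r (Finset.univ.image A) := by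
  classical
  intro T hT hn hr
  let T' : Finset α := Finset.univ.filter (fun a => A a ∈ T)
  have hTT : T = T'.image A := by
    ext P
    simp only [T', Finset.mem_image, Finset.mem_filter, Finset.mem_univ, true_and]
    constructor
    · intro hP
      obtain ⟨a, -, rfl⟩ := Finset.mem_image.1 (hT hP)
      exact ⟨a, hP, rfl⟩
    · rintro ⟨a, ha, rfl⟩; exact ha
  have hn' : T'.Nonempty := by
    rw [hTT] at hn; simpa using hn
  obtain ⟨k, hk, hmax⟩ := Finset.exists_max_image T' lab hn'
  apply h T' k hk hmax
  have e : (fun x => ∑ t ∈ T', A t x) = (fun x => ∑ P ∈ T, P x) := by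
    funext x
    rw [hTT, Finset.sum_image (fun a _ b _ hab => h.inj hab)]
  rw [e]
  refine RankLE.mono hr ?_ le_rfl
  apply Nat.sub_le_sub_right
  apply Finset.sup_le
  intro P hP
  rw [hTT] at hP
  obtain ⟨a, ha, rfl⟩ := Finset.mem_image.1 hP
  exact (fdeg_le (hA a)).trans (hmax a ha)

lemma extract {m : ℕ} {α : Type} {r : ℕ} (l : ℕ) (A : α → Fn m) (T : Finset α) (k : α)
    (hk : k ∈ T) (h : RankLE (l - 1) r (fun x => ∑ t ∈ T, A t x)) :
    ∃ Q : {q : Fin r // 0 < l} → Fn m, (∀ q, DegLE (l - 1) (Q q)) ∧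
      ∀ x y, (∀ t, t ≠ k → A t x = A t y) → (∀ q, Q q x = Q q y) → A k x = A k y := by
  classical
  obtain ⟨Q, Γ, hQ, hP⟩ := h
  refine ⟨fun q => Q q.1, fun q => hQ _, ?_⟩
  intro x y h1 h2
  have h3 : (fun j => Q j x) = fun j => Q j y := by
    funext j
    by_cases hl : 0 < l
    · exact h2 ⟨j, hl⟩
    · have := hQ j
      rw [show l - 1 = 0 by omega] at this
      exact degLE_const this x y
  have h4 : ∑ t ∈ T, A t x = ∑ t ∈ T, A t y := by
    have hx := hP x
    have hy := hP y
    simp only at hx hy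
    rw [hx, hy, h3]
  rw [← Finset.add_sum_erase _ _ hk, ← Finset.add_sum_erase _ _ hk] at h4
  have h5 : ∑ t ∈ T.erase k, A t x = ∑ t ∈ T.erase k, A t y :=
    Finset.sum_congr rfl (fun t ht => h1 t (Finset.ne_of_mem_erase ht))
  rw [h5] at h4
  exact add_right_cancel h4

lemma indep {V : Type} [DecidableEq V] (R : V → V → Prop) [DecidableRel R] (D : ℕ) :
    ∀ s : ℕ, ∀ S : Finset V, S.card = s →
      (∀ i ∈ S, (S.filter (fun j => j ≠ i ∧ R i j)).card ≤ D) →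
      ∃ S' ⊆ S, (∀ i ∈ S', ∀ j ∈ S', i ≠ j → ¬ R i j) ∧ S.card ≤ S'.card * (2 * D + 1) := by
  intro s
  induction s using Nat.strong_induction_on with
  | _ s ih =>
  intro S hs hD
  rcases S.eq_empty_or_nonempty with rfl | hne
  · exact ⟨∅, by simp, by simp, by simp⟩
  have hdc := Finset.sum_card_bipartiteAbove_eq_sum_card_bipartiteBelow (s := S) (t := S)
    (fun i j => j ≠ i ∧ R i j)
  have hv : ∃ v ∈ S, (S.filter (fun i => v ≠ i ∧ R i v)).card ≤ D := by
    by_contra hcon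
    push Not at hcon
    have h1 : ∑ a ∈ S, (S.filter (fun j => j ≠ a ∧ R a j)).card ≤ ∑ a ∈ S, D :=
      Finset.sum_le_sum hD
    have h2 : ∑ a ∈ S, D < ∑ a ∈ S, (S.filter (fun i => a ≠ i ∧ R i a)).card :=
      Finset.sum_lt_sum_of_nonempty hne hcon
    simp only [Finset.bipartiteAbove, Finset.bipartiteBelow] at hdc
    omega
  obtain ⟨v, hvS, hvD⟩ := hv
  obtain ⟨X, hX⟩ : ∃ X, X = insert v (S.filter (fun j => j ≠ v ∧ R v j) ∪
    S.filter (fun i => v ≠ i ∧ R i v)) := ⟨_, rfl⟩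
  have hXc : X.card ≤ 2 * D + 1 := by
    have h1 := Finset.card_insert_le v
      (S.filter (fun j => j ≠ v ∧ R v j) ∪ S.filter (fun i => v ≠ i ∧ R i v))
    have h2 := Finset.card_union_le (S.filter (fun j => j ≠ v ∧ R v j))
      (S.filter (fun i => v ≠ i ∧ R i v))
    have h3 := hD v hvS
    rw [hX]
    omega
  have hlt : (S \ X).card < s := by
    rw [← hs]
    apply Finset.card_lt_card
    refine ⟨Finset.sdiff_subset, fun hh => ?_⟩
    have := hh hvS
    simp [hX] at this
  obtain ⟨S', hS', hI, hc⟩ := ih _ hlt (S \ X) rfl (by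
    intro i hi
    refine (Finset.card_le_card ?_).trans (hD i (Finset.sdiff_subset hi))
    exact Finset.filter_subset_filter _ Finset.sdiff_subset)
  have hvS' : v ∉ S' := fun hh => by
    have := hS' hh
    simp [hX] at this
  refine ⟨insert v S', ?_, ?_, ?_⟩
  · intro a ha
    rcases Finset.mem_insert.1 ha with rfl | ha
    · exact hvS
    · exact Finset.sdiff_subset (hS' ha)
  · have aux : ∀ a ∈ S', ¬ R v a ∧ ¬ R a v := by
      intro a ha
      have h1 := hS' ha
      simp only [hX, Finset.mem_sdiff, Finset.mem_insert, Finset.mem_union, Finset.mem_filter,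
        not_or, not_and] at h1
      obtain ⟨h1, h2, h3, h4⟩ := h1
      exact ⟨h3 h1 h2, h4 h1 (Ne.symm h2)⟩
    intro i hi j hj hij
    rcases Finset.mem_insert.1 hi with hi | hi <;> rcases Finset.mem_insert.1 hj with hj | hj
    · exact absurd (hi.trans hj.symm) hij
    · rw [hi]; exact (aux _ hj).1
    · rw [hj]; exact (aux _ hi).2
    · exact hI _ hi _ hj hij
  · rw [Finset.card_insert_of_notMem hvS']
    have h1 : S.card ≤ (S \ X).card + X.card := by
      have := Finset.card_le_card (show S ⊆ (S \ X) ∪ X by intro a ha; by_cases h : a ∈ X <;> simp [h, ha])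
      exact this.trans (Finset.card_union_le _ _)
    nlinarith

/-- labels of the family obtained by replacing `k` with `r` functions of smaller label. -/
def nlab {ι : Type} (lab : ι → ℕ) (k : ι) (r : ℕ) :
    {a : ι // a ≠ k} ⊕ {q : Fin r // 0 < lab k} → ℕ :=
  Sum.elim (fun a => lab a.1) (fun _ => lab k - 1)

def pot {ι : Type} [Fintype ι] (lab : ι → ℕ) : Multiset ℕ := Finset.univ.val.map lab

lemma pot_lt {ι : Type} [Fintype ι] [DecidableEq ι] (lab : ι → ℕ) (k : ι) (r : ℕ) :
    Multiset.IsDershowitzMannaLT (pot (nlab lab k r)) (pot lab) := by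
  refine ⟨(Finset.univ : Finset {a : ι // a ≠ k}).val.map (fun a => lab a.1),
    (Finset.univ : Finset {q : Fin r // 0 < lab k}).val.map (fun _ => lab k - 1), {lab k},
    by simp, ?_, ?_, ?_⟩
  · unfold pot nlab
    rw [← Finset.univ_disjSum_univ]
    simp [Finset.disjSum, Multiset.disjSum]
  · unfold pot
    have h : (Finset.univ : Finset ι).val = k ::ₘ ((Finset.univ : Finset {a : ι // a ≠ k}).val.map Subtype.val) := by
      have h1 : (Finset.univ : Finset ι) = Finset.cons k
        ((Finset.univ : Finset {a : ι // a ≠ k}).map (Function.Embedding.subtype _)) (by simp) := by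
        ext a; by_cases h : a = k <;> simp [h]
      rw [h1]; rfl
    rw [h]
    simp [add_comm]
  · intro y hy
    simp only [Multiset.mem_map] at hy
    obtain ⟨q, -, rfl⟩ := hy
    exact ⟨lab k, by simp, by have := q.2; omega⟩

lemma nlab_le {ι : Type} {lab : ι → ℕ} {k : ι} {r d : ℕ} (h : ∀ a, lab a ≤ d) :
    ∀ a, nlab lab k r a ≤ d := by
  rintro (a | a)
  · exact h _
  · exact (Nat.sub_le _ _).trans (h k)

/-- output property -/
def Out (f : ℕ → ℕ) (d N n m : ℕ) {κ ι : Type} (S : Finset (Fin n)) (C : κ → Fn m)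
    (H : Fin n → ι → Fn m) : Prop :=
  ∃ S' ⊆ S, 2 ≤ S'.card ∧ S.card ≤ S'.card ^ N ∧
    ∃ (G : Fin n → Finset (Fn m)) (C0 : Finset (Fn m)), ∀ i ∈ S',
      (∀ P ∈ G i, DegLE d P) ∧ (G i).card ≤ N ∧
      (∀ x y, (∀ Q ∈ G i, Q x = Q y) → (∀ k, C k x = C k y) ∧ ∀ k, H i k x = H i k y) ∧
      ∀ j ∈ S', FinsetRegular (f ((G i ∪ G j).card)) (G i ∪ G j) ∧ (i ≠ j → G i ∩ G j = C0)

def Claim (f : ℕ → ℕ) (d N : ℕ) {κ ι : Type} (labC : κ → ℕ) (labH : ι → ℕ) : Prop :=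
  ∀ n m : ℕ, ∀ S : Finset (Fin n), N ≤ S.card → ∀ (C : κ → Fn m) (H : Fin n → ι → Fn m),
    (∀ k, DegLE (labC k) (C k)) → (∀ i ∈ S, ∀ k, DegLE (labH k) (H i k)) →
    Out f d N n m S C H

lemma Out.mono {f : ℕ → ℕ} {d N N' n m : ℕ} {κ ι κ' ι' : Type} {S : Finset (Fin n)}
    {C : κ → Fn m} {H : Fin n → ι → Fn m} {C' : κ' → Fn m} {H' : Fin n → ι' → Fn m}
    (h : Out f d N n m S C H) (hN : N ≤ N')
    (hdet : ∀ i ∈ S, ∀ x y, (∀ k, C k x = C k y) → (∀ k, H i k x = H i k y) →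
      (∀ k, C' k x = C' k y) ∧ (∀ k, H' i k x = H' i k y)) :
    Out f d N' n m S C' H' := by
  obtain ⟨S', hS, h2, hc, G, C0, hG⟩ := h
  refine ⟨S', hS, h2, hc.trans (Nat.pow_le_pow_right (by omega) hN), G, C0, fun i hi => ?_⟩
  obtain ⟨a, b, c, e⟩ := hG i hi
  exact ⟨a, b.trans hN, fun x y hxy => hdet i (hS hi) x y (c x y hxy).1 (c x y hxy).2, e⟩

def E {m r : ℕ} {κ ι : Type} (labH : ι → ℕ) (C : κ → Fn m) (Hi Hj : ι → Fn m) (k : ι)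
    (Q : {q : Fin r // 0 < labH k} → Fn m) : Prop :=
  (∀ q, DegLE (labH k - 1) (Q q)) ∧ ∀ x y, (∀ a, C a x = C a y) → (∀ a, Hi a x = Hi a y) →
    (∀ a, a ≠ k → Hj a x = Hj a y) → (∀ q, Q q x = Q q y) → Hj k x = Hj k y

lemma bad_pair {m r : ℕ} {κ ι : Type} [Fintype κ] [Fintype ι] (labC : κ → ℕ) (labH : ι → ℕ)
    (C : κ → Fn m) (Hi Hj : ι → Fn m)
    (hi : ∀ k, DegLE (labH k) (Hi k)) (hj : ∀ k, DegLE (labH k) (Hj k))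
    (hC : LReg (r + 2 * Fintype.card ι) labC C)
    (hb : ¬ LReg r (Sum.elim labC (Sum.elim labH labH)) (Sum.elim C (Sum.elim Hi Hj))) :
    (∃ k, ∃ Q : {q : Fin r // 0 < labH k} → Fn m, E labH C Hi Hj k Q) ∨
    (∃ k, ∃ Q : {q : Fin r // 0 < labH k} → Fn m, E labH C Hj Hi k Q) := by
  classical
  unfold LReg at hb
  push Not at hb
  obtain ⟨T, k, hk, hmax, hr⟩ := hb
  set A : κ ⊕ (ι ⊕ ι) → Fn m := Sum.elim C (Sum.elim Hi Hj) with hA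
  set lab : κ ⊕ (ι ⊕ ι) → ℕ := Sum.elim labC (Sum.elim labH labH) with hlab
  by_cases h1 : ∃ b, Sum.inr (Sum.inr b) ∈ T ∧ lab k ≤ labH b
  · obtain ⟨b, hb, hle⟩ := h1
    have hle' : labH b ≤ lab k := hmax _ hb
    have he : lab k = labH b := le_antisymm hle hle'
    rw [he] at hr
    obtain ⟨Q, hQ, hd⟩ := extract (labH b) A T _ hb hr
    refine Or.inl ⟨b, Q, hQ, ?_⟩
    intro x y h1 h2 h3 h4
    refine hd x y ?_ h4
    rintro (t | t | t) ht
    · exact h1 t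
    · exact h2 t
    · exact h3 t (by rintro rfl; exact ht rfl)
  by_cases h2 : ∃ b, Sum.inr (Sum.inl b) ∈ T ∧ lab k ≤ labH b
  · obtain ⟨b, hb, hle⟩ := h2
    have hle' : labH b ≤ lab k := hmax _ hb
    have he : lab k = labH b := le_antisymm hle hle'
    rw [he] at hr
    obtain ⟨Q, hQ, hd⟩ := extract (labH b) A T _ hb hr
    refine Or.inr ⟨b, Q, hQ, ?_⟩
    intro x y h1 h2 h3 h4
    refine hd x y ?_ h4
    rintro (t | t | t) ht
    · exact h1 t
    · exact h3 t (by rintro rfl; exact ht rfl)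
    · exact h2 t
  exfalso
  push Not at h1 h2
  rcases k with k | k | k
  · have hkk : lab (Sum.inl k) = labC k := rfl
    rw [hkk] at h1 h2 hmax hr
    obtain ⟨Q, Γ, hQ, hP⟩ := hr
    refine hC T.toLeft k (by simpa using hk) (fun t ht => hmax (Sum.inl t) (by simpa using ht)) ?_
    refine rankLE_of (β := Fin r ⊕ (ι ⊕ ι)) (by simp; omega)
      (Sum.elim Q (fun s => if Sum.inr s ∈ T then A (Sum.inr s) else fun _ => 0)) ?_ _ ?_
    · rintro (q | s)
      · exact hQ q
      · simp only [Sum.elim_inr]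
        split_ifs with hs
        · rcases s with s | s
          · exact degLE_mono (hi s) (by have := h2 s hs; omega)
          · exact degLE_mono (hj s) (by have := h1 s hs; omega)
        · exact degLE_zero
    · intro x y hxy
      have hx := hP x
      have hy := hP y
      simp only at hx hy
      have e1 : (fun j => Q j x) = fun j => Q j y := by
        funext j; exact hxy (Sum.inl j)
      have e2 : ∑ t ∈ T, A t x = ∑ t ∈ T, A t y := by rw [hx, hy, e1]
      have e3 : ∀ x, ∑ t ∈ T, A t x = ∑ t ∈ T.toLeft, C t x + ∑ t ∈ T.toRight, A (Sum.inr t) x := by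
        intro x
        conv_lhs => rw [← Finset.toLeft_disjSum_toRight (u := T), Finset.sum_disjSum]
        rfl
      rw [e3, e3] at e2
      have e4 : ∑ t ∈ T.toRight, A (Sum.inr t) x = ∑ t ∈ T.toRight, A (Sum.inr t) y := by
        refine Finset.sum_congr rfl (fun t ht => ?_)
        have := hxy (Sum.inr t)
        have ht' : Sum.inr t ∈ T := by simpa using ht
        simpa only [Sum.elim_inr, if_pos ht'] using this
      rw [e4] at e2
      exact add_right_cancel e2
  · exact absurd (h2 k hk) (lt_irrefl _)
  · exact absurd (h1 k hk) (lt_irrefl _)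

lemma final {f : ℕ → ℕ} (hf : Monotone f) {d N n m : ℕ} {κ ι : Type} [Fintype κ] [Fintype ι]
    (labC : κ → ℕ) (labH : ι → ℕ) (hdC : ∀ k, labC k ≤ d) (hdH : ∀ k, labH k ≤ d)
    (S S' : Finset (Fin n)) (hS : S' ⊆ S) (C : κ → Fn m) (H : Fin n → ι → Fn m)
    (hC : ∀ k, DegLE (labC k) (C k)) (hH : ∀ i ∈ S, ∀ k, DegLE (labH k) (H i k))
    (h2 : 2 ≤ S'.card) (hc : S.card ≤ S'.card ^ N) (hN : Fintype.card κ + Fintype.card ι ≤ N)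
    (hreg : ∀ i ∈ S', ∀ j ∈ S', i ≠ j →
      LReg (f (Fintype.card κ + 2 * Fintype.card ι)) (Sum.elim labC (Sum.elim labH labH))
        (Sum.elim C (Sum.elim (H i) (H j)))) : Out f d N n m S C H := by
  classical
  refine ⟨S', hS, h2, hc, fun i => Finset.univ.image C ∪ Finset.univ.image (H i),
    Finset.univ.image C, fun i hi => ⟨?_, ?_, ?_, ?_⟩⟩
  · intro P hP
    simp only [Finset.mem_union, Finset.mem_image, Finset.mem_univ, true_and] at hP
    rcases hP with ⟨a, rfl⟩ | ⟨a, rfl⟩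
    · exact degLE_mono (hC a) (hdC a)
    · exact degLE_mono (hH i (hS hi) a) (hdH a)
  · refine (Finset.card_union_le _ _).trans (le_trans ?_ hN)
    exact add_le_add Finset.card_image_le Finset.card_image_le
  · intro x y hxy
    exact ⟨fun k => hxy _ (by simp), fun k => hxy _ (by simp)⟩
  · have key : ∀ j ∈ S', i ≠ j → 
        FinsetRegular (f (Fintype.card κ + 2 * Fintype.card ι))
          ((Finset.univ.image C ∪ Finset.univ.image (H i)) ∪
          (Finset.univ.image C ∪ Finset.univ.image (H j))) := by
      intro j hj hij
      have h := (hreg i hi j hj hij).fin (by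
        rintro (a | a | a)
        · exact hC a
        · exact hH i (hS hi) a
        · exact hH j (hS hj) a)
      refine FReg.mono h le_rfl ?_
      intro P hP
      simp only [Finset.mem_union, Finset.mem_image, Finset.mem_univ, true_and] at hP ⊢
      rcases hP with (⟨a, rfl⟩ | ⟨a, rfl⟩) | (⟨a, rfl⟩ | ⟨a, rfl⟩)
      · exact ⟨Sum.inl a, rfl⟩
      · exact ⟨Sum.inr (Sum.inl a), rfl⟩
      · exact ⟨Sum.inl a, rfl⟩
      · exact ⟨Sum.inr (Sum.inr a), rfl⟩
    have hcard : ∀ j, ((Finset.univ.image C ∪ Finset.univ.image (H i)) ∪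
          (Finset.univ.image C ∪ Finset.univ.image (H j))).card ≤
          Fintype.card κ + 2 * Fintype.card ι := by
      intro j
      rw [← Finset.union_union_distrib_left]
      have a1 := Finset.card_union_le (Finset.univ.image C)
        (Finset.univ.image (H i) ∪ Finset.univ.image (H j))
      have a2 := Finset.card_union_le (Finset.univ.image (H i)) (Finset.univ.image (H j))
      have a3 : (Finset.univ.image C).card ≤ Fintype.card κ := Finset.card_image_le
      have a4 : (Finset.univ.image (H i)).card ≤ Fintype.card ι := Finset.card_image_le
      have a5 : (Finset.univ.image (H j)).card ≤ Fintype.card ι := Finset.card_image_le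
      omega
    intro j hj
    refine ⟨?_, ?_⟩
    · by_cases hij : i = j
      · subst hij
        obtain ⟨j, hj, hji⟩ := Finset.exists_mem_ne (show 1 < S'.card by omega) i
        refine FReg.mono (key j hj hji.symm) (hf (hcard i)) ?_
        rw [Finset.union_self]
        exact Finset.subset_union_left
      · exact FReg.mono (key j hj hij) (hf (hcard j)) (Finset.Subset.refl _)
    · intro hij
      have hinj := (hreg i hi j hj hij).inj
      rw [← Finset.union_inter_distrib_left]
      rw [Finset.union_eq_left]
      intro P hP
      simp only [Finset.mem_inter, Finset.mem_image, Finset.mem_univ, true_and] at hP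
      obtain ⟨⟨a, ha⟩, b, hb⟩ := hP
      have := @hinj (Sum.inr (Sum.inl a)) (Sum.inr (Sum.inr b)) (by simp [ha, hb])
      simp at this

lemma main {f : ℕ → ℕ} (hf : Monotone f) (d : ℕ) : ∀ M : Multiset ℕ, ∀ M' : Multiset ℕ,
    ∀ (κ ι : Type) [Fintype κ] [Fintype ι] (labC : κ → ℕ) (labH : ι → ℕ),
    (∀ k, labC k ≤ d) → (∀ k, labH k ≤ d) → pot labH = M → pot labC = M' →
    ∃ N, Claim f d N labC labH := by
  classical
  intro M
  induction M using (Multiset.wellFounded_isDershowitzMannaLT (α := ℕ)).induction with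
  | _ M ihM =>
  intro M'
  induction M' using (Multiset.wellFounded_isDershowitzMannaLT (α := ℕ)).induction with
  | _ M' ihM' =>
  intro κ ι _ _ labC labH hdC hdH hM hM'
  set c := Fintype.card κ with hc
  set h := Fintype.card ι with hh
  set r := f (c + 2 * h) with hr
  set R := r + 2 * h with hR
  have hA : ∀ k : κ, ∃ N, Claim f d N (nlab labC k R) labH := fun k =>
    ihM' _ (hM' ▸ pot_lt labC k R) _ _ _ _ (nlab_le hdC) hdH hM rfl
  have hB : ∀ k : ι, ∃ N, Claim f d N (Sum.elim labC labH) (nlab labH k r) := fun k =>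
    ihM _ (hM ▸ pot_lt labH k r) _ _ _ _ _
      (by rintro (a | a); exacts [hdC a, hdH a]) (nlab_le hdH) rfl rfl
  choose NA hNA using hA
  choose NB hNB using hB
  set L := Finset.univ.sup NA + Finset.univ.sup NB with hL
  have hLA : ∀ k, NA k ≤ L := fun k =>
    (Finset.le_sup (f := NA) (Finset.mem_univ k)).trans (Nat.le_add_right _ _)
  have hLB : ∀ k, NB k ≤ L := fun k =>
    (Finset.le_sup (f := NB) (Finset.mem_univ k)).trans (Nat.le_add_left _ _)
  refine ⟨(h * L) ^ 2 + h ^ 2 + 2 * L + 9 + c + h, ?_⟩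
  set N := (h * L) ^ 2 + h ^ 2 + 2 * L + 9 + c + h with hN
  intro n m S hS C H hC hH
  by_cases hreg : LReg R labC C
  swap
  · unfold LReg at hreg
    push Not at hreg
    obtain ⟨T, k, hk, hmax, hrk⟩ := hreg
    obtain ⟨Q, hQ, hd⟩ := extract (labC k) C T k hk hrk
    have := hNA k n m S ((hLA k).trans (by omega)) (Sum.elim (fun a => C a.1) Q) H
      (by
        rintro (a | a)
        · exact hC a
        · exact hQ a) hH
    refine this.mono ((hLA k).trans (by omega)) ?_
    intro i hi x y h1 h2
    refine ⟨fun a => ?_, h2⟩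
    by_cases hak : a = k
    · subst hak
      exact hd x y (fun t ht => h1 (Sum.inl ⟨t, ht⟩)) (fun q => h1 (Sum.inr q))
    · exact h1 (Sum.inl ⟨a, hak⟩)
  let Rel : Fin n → Fin n → Prop := fun i j => 
    ∃ k, ∃ Q : {q : Fin r // 0 < labH k} → Fn m, E labH C (H i) (H j) k Q
  set q := Nat.sqrt S.card with hq
  have hq1 : q * q ≤ S.card := Nat.sqrt_le S.card
  have hq2 : S.card < (q + 1) * (q + 1) := Nat.lt_succ_sqrt S.card
  have hq3 : 3 ≤ q := by rw [hq, Nat.le_sqrt]; omega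
  by_cases hD : ∀ i ∈ S, (S.filter (fun j => j ≠ i ∧ Rel i j)).card ≤ q
  · obtain ⟨S', hSS, hI, hcard⟩ := indep Rel q _ S rfl hD
    have hw2 : 2 ≤ S'.card := by
      by_contra hlt
      have : S'.card ≤ 1 := by omega
      nlinarith
    refine final hf labC labH hdC hdH S S' hSS C H hC hH hw2 ?_ (by omega) ?_
    · have hqw : q ≤ 3 * S'.card := by nlinarith
      have h7 : S.card ≤ 2 ^ 3 * S'.card ^ 2 := by nlinarith
      calc S.card ≤ 2 ^ 3 * S'.card ^ 2 := h7
        _ ≤ S'.card ^ 3 * S'.card ^ 2 := Nat.mul_le_mul_right _ (Nat.pow_le_pow_left hw2 3)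
        _ = S'.card ^ 5 := by ring
        _ ≤ S'.card ^ N := Nat.pow_le_pow_right (by omega) (by omega)
    · intro i hi j hj hij
      by_contra hb
      rcases bad_pair labC labH C (H i) (H j) (hH i (hSS hi)) (hH j (hSS hj)) hreg hb with h1 | h1
      · exact hI i hi j hj hij h1
      · exact hI j hj i hi hij.symm h1
  · push Not at hD
    obtain ⟨i, hi, hD⟩ := hD
    set B := S.filter (fun j => j ≠ i ∧ Rel i j) with hBdef
    let Sk : ι → Finset (Fin n) := fun k => 
      S.filter (fun j => ∃ Q : {q : Fin r // 0 < labH k} → Fn m, E labH C (H i) (H j) k Q)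
    have hcov : B ⊆ Finset.univ.biUnion Sk := by
      intro j hj
      rw [hBdef, Finset.mem_filter] at hj
      obtain ⟨hjS, -, k, hk⟩ := hj
      exact Finset.mem_biUnion.2 ⟨k, Finset.mem_univ _, Finset.mem_filter.2 ⟨hjS, hk⟩⟩
    have hpig : ∃ k, q + 1 ≤ h * (Sk k).card := by
      by_contra hcon
      push Not at hcon
      have h1 : B.card ≤ ∑ k, (Sk k).card :=
        (Finset.card_le_card hcov).trans Finset.card_biUnion_le
      have hne : (Finset.univ : Finset ι).Nonempty := by
        by_contra hemp
        rw [Finset.not_nonempty_iff_eq_empty] at hemp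
        rw [hemp] at h1
        simp at h1
        simp [h1] at hD
      have h2 : ∑ k, h * (Sk k).card ≤ ∑ k : ι, q :=
        Finset.sum_le_sum (fun k _ => by have := hcon k; omega)
      rw [← Finset.mul_sum] at h2
      simp only [Finset.sum_const, Finset.card_univ, smul_eq_mul] at h2
      have hpos : 0 < h := by rw [hh, ← Finset.card_univ]; exact hne.card_pos
      have := Nat.le_of_mul_le_mul_left h2 hpos
      omega
    obtain ⟨k, hk⟩ := hpig
    have hSkS : Sk k ⊆ S := Finset.filter_subset _ _
    have hspec : ∀ j, ∃ Q : {q : Fin r // 0 < labH k} → Fn m, j ∈ Sk k →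
        E labH C (H i) (H j) k Q := by
      intro j
      by_cases hj : j ∈ Sk k
      · obtain ⟨Q, hQ⟩ := (Finset.mem_filter.1 hj).2
        exact ⟨Q, fun _ => hQ⟩
      · exact ⟨fun _ _ => 0, fun h => absurd h hj⟩
    choose Q hQ using hspec
    have hkpos : 0 < h := by
      rcases Nat.eq_zero_or_pos h with h0 | h0
      · rw [h0] at hk; omega
      · exact h0
    have hsz : NB k ≤ (Sk k).card := by
      refine (hLB k).trans ?_
      by_contra hlt
      push Not at hlt
      have h1 : q + 1 ≤ h * L := hk.trans (Nat.mul_le_mul_left _ hlt.le)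
      have h2 : (q + 1) * (q + 1) ≤ (h * L) ^ 2 := by
        rw [pow_two]; exact Nat.mul_le_mul h1 h1
      omega
    have hout := hNB k n m (Sk k) hsz (Sum.elim C (H i))
      (fun j => Sum.elim (fun a => H j a.1) (Q j))
      (by
        rintro (a | a)
        · exact hC a
        · exact hH i hi a)
      (by
        rintro j hj (a | a)
        · exact hH j (hSkS hj) a
        · exact (hQ j hj).1 a)
    have hout2 : Out f d (NB k) n m (Sk k) C H := by
      refine hout.mono le_rfl ?_
      intro j hj x y h1 h2
      refine ⟨fun a => h1 (Sum.inl a), fun a => ?_⟩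
      by_cases hak : a = k
      · subst hak
        exact (hQ j hj).2 x y (fun a => h1 (Sum.inl a)) (fun a => h1 (Sum.inr a))
          (fun t ht => h2 (Sum.inl ⟨t, ht⟩)) (fun q => h2 (Sum.inr q))
      · exact h2 (Sum.inl ⟨a, hak⟩)
    obtain ⟨S', hS', hw2, hcard, G, C0, hG⟩ := hout2
    refine ⟨S', hS'.trans hSkS, hw2, ?_, G, C0, fun j hj => ?_⟩
    · have h1 : q + 1 ≤ h * S'.card ^ L :=
        hk.trans (Nat.mul_le_mul_left _ (hcard.trans (Nat.pow_le_pow_right (by omega) (hLB k))))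
      calc S.card ≤ (q + 1) * (q + 1) := hq2.le
        _ ≤ (h * S'.card ^ L) * (h * S'.card ^ L) := Nat.mul_le_mul h1 h1
        _ = h ^ 2 * S'.card ^ (2 * L) := by ring
        _ ≤ S'.card ^ (h ^ 2) * S'.card ^ (2 * L) := 
            Nat.mul_le_mul_right _ (Nat.lt_pow_self (by omega)).le
        _ = S'.card ^ (h ^ 2 + 2 * L) := by ring
        _ ≤ S'.card ^ N := Nat.pow_le_pow_right (by omega) (by omega)
    · obtain ⟨a, b, e, g⟩ := hG j hj
      exact ⟨a, b.trans ((hLB k).trans (by omega)), e, g⟩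

lemma enum {m K d : ℕ} (F : Finset (Fn m)) (hF : F.card ≤ K) (hd : ∀ P ∈ F, DegLE d P) :
    ∃ g : Fin K → Fn m, (∀ k, DegLE d (g k)) ∧ ∀ P ∈ F, ∃ k, g k = P := by
  classical
  refine ⟨fun k => if hk : k.1 < F.card then (F.equivFin.symm ⟨k.1, hk⟩).1 else fun _ => 0, ?_, ?_⟩
  · intro k
    dsimp only
    split_ifs
    · exact hd _ (F.equivFin.symm _).2
    · exact degLE_zero
  · intro P hP
    exact ⟨⟨(F.equivFin ⟨P, hP⟩).1, (F.equivFin ⟨P, hP⟩).2.trans_le hF⟩, by simp⟩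

end SPR

open SPR in
/-- sunflower pairwise regularization. -/
theorem sunflower_pairwise_regularization :
    ∀ f : ℕ → ℕ, GrowthFn f → ∀ K d : ℕ, 0 < K → 0 < d →
      ∃ ε > (0:ℝ), ∃ K' n₀ : ℕ, ∀ n : ℕ, n₀ ≤ n → ∀ m : ℕ,
        ∀ F : Fin n → Finset ((Fin m → ZMod 2) → ZMod 2),
          (∀ i, (F i).card ≤ K) → (∀ i, ∀ P ∈ F i, DegLE d P) →
          ∃ w : ℕ, (n:ℝ) ^ ε ≤ (w:ℝ) ∧
          ∃ π : Fin w → Fin n, StrictMono π ∧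
          ∃ G : Fin w → Finset ((Fin m → ZMod 2) → ZMod 2),
            (∀ i, ∀ P ∈ G i, DegLE d P) ∧
            (∀ i, FinsetRefines (G i) (F (π i))) ∧
            (∀ i, (G i).card ≤ K') ∧
            (∀ i j, FinsetRegular (f ((G i ∪ G j).card)) (G i ∪ G j)) ∧
            (∀ i j, i ≠ j → G i ∩ G j = Finset.univ.inf G) := by
  intro f hf K d hK hd
  obtain ⟨N, hN⟩ := SPR.main hf.1 d _ _ Empty (Fin K) (fun _ => d) (fun _ => d)
    (fun _ => le_rfl) (fun _ => le_rfl) rfl rfl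
  refine ⟨1 / ((N : ℝ) + 1), by positivity, N, N, ?_⟩
  intro n hn m F hFK hFd
  choose g hg1 hg2 using fun i => SPR.enum (F i) (hFK i) (hFd i)
  obtain ⟨S', -, hw2, hcard, G, C0, hG⟩ := hN n m Finset.univ (by simpa using hn)
    (fun e => e.elim) g (fun e => e.elim) (fun i _ k => hg1 i k)
  refine ⟨S'.card, ?_, S'.orderEmbOfFin rfl, (S'.orderEmbOfFin rfl).strictMono,
    fun i => G (S'.orderEmbOfFin rfl i), ?_, ?_, ?_, ?_, ?_⟩
  · have h1 : n ≤ S'.card ^ (N + 1) := by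
      rw [Finset.card_univ, Fintype.card_fin] at hcard
      exact hcard.trans (Nat.pow_le_pow_right (by omega) (by omega))
    have h2 : (n : ℝ) ≤ (S'.card : ℝ) ^ ((N : ℝ) + 1) := by
      have : (n : ℝ) ≤ (S'.card : ℝ) ^ (N + 1) := by exact_mod_cast h1
      rw [← Nat.cast_succ, Real.rpow_natCast]; exact this
    calc (n : ℝ) ^ (1 / ((N : ℝ) + 1)) ≤ ((S'.card : ℝ) ^ ((N : ℝ) + 1)) ^ (1 / ((N : ℝ) + 1)) :=
          Real.rpow_le_rpow (by positivity) h2 (by positivity)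
      _ = (S'.card : ℝ) := by
          rw [← Real.rpow_mul (by positivity), mul_one_div_cancel (by positivity), Real.rpow_one]
  · intro i
    exact (hG _ (S'.orderEmbOfFin_mem rfl i)).1
  · intro i P hP
    obtain ⟨k, hk⟩ := hg2 _ P hP
    refine SPR.factor (fun Q : {Q // Q ∈ G (S'.orderEmbOfFin rfl i)} => Q.1) P ?_
    intro x y hxy
    rw [← hk]
    exact ((hG _ (S'.orderEmbOfFin_mem rfl i)).2.2.1 x y (fun Q hQ => hxy ⟨Q, hQ⟩)).2 k
  · intro i
    exact (hG _ (S'.orderEmbOfFin_mem rfl i)).2.1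
  · intro i j
    convert ((hG _ (S'.orderEmbOfFin_mem rfl i)).2.2.2 _ (S'.orderEmbOfFin_mem rfl j)).1
  · have key : ∀ i j : Fin S'.card, i ≠ j →
        G (S'.orderEmbOfFin rfl i) ∩ G (S'.orderEmbOfFin rfl j) = C0 := by
      intro i j hij
      convert ((hG _ (S'.orderEmbOfFin_mem rfl i)).2.2.2 _ (S'.orderEmbOfFin_mem rfl j)).2
        (fun h => hij ((S'.orderEmbOfFin rfl).injective h))
    intro i j hij
    apply le_antisymm
    · apply Finset.le_inf
      intro l _
      rw [key i j hij]
      by_cases hl : l = i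
      · subst hl
        rw [← key l j hij]; exact Finset.inter_subset_left
      · rw [← key l i hl]; exact Finset.inter_subset_left
    · intro P hP
      rw [Finset.mem_inter]
      exact ⟨Finset.inf_le (f := fun i => G (S'.orderEmbOfFin rfl i)) (Finset.mem_univ i) hP,
        Finset.inf_le (f := fun i => G (S'.orderEmbOfFin rfl i)) (Finset.mem_univ j) hP⟩
end
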